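/- arXiv:1606.05722 — 2 statements merged into one kernel-verified Lean document; each statement's English description precedes it below -/
import Mathlib

section
/- For every positive integer r, the set A_r = ⋃_{p prime} [rp, (r+1)p) is cofinite in the natural numbers; equivalently, for all sufficiently large integers n there exists a prime p with n/(r+1) < p ≤ n/r. -/
open MeasureTheory Filter Topology Complex FourierTransform
theorem kernel_exists : ∃ (φ : ℝ → ℂ) (f : ℝ → ℝ) (c M : ℝ), Continuous φ ∧ HasCompactSupport φ ∧
    (∀ u, 𝓕 φ u = f u) ∧ Integrable f ∧ 0 < ∫ u, f u ∧ 0 < c ∧ 0 < M ∧ (∀ u, f u ≤ M) ∧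
    (∀ u, c ≤ |u| → f u ≤ 0) := by
  let b : ContDiffBump (0 : ℝ) := ⟨1, 2, by norm_num, by norm_num⟩
  let η : ℝ → ℂ := fun t => ((b t : ℝ) : ℂ)
  have hηs : ContDiff ℝ ((⊤ : ℕ∞) : WithTop ℕ∞) η := Complex.ofRealCLM.contDiff.comp b.contDiff
  have hηc : HasCompactSupport η := b.hasCompactSupport.comp_left (g := fun x : ℝ => (x : ℂ)) rfl
  have hηcont : Continuous η := hηs.continuous
  have hηi : Integrable η := hηcont.integrable_of_hasCompactSupport hηc
  have hdc : HasCompactSupport (deriv η) := hηc.deriv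
  have hdcont : Continuous (deriv η) := hηs.continuous_deriv (by simp)
  have hdi : Integrable (deriv η) := hdcont.integrable_of_hasCompactSupport hdc
  have hD : ∀ u : ℝ, 𝓕 (deriv η) u = (2 * Real.pi * Complex.I * u) * 𝓕 η u := by
    intro u
    rw [Real.fourier_deriv hηi (hηs.differentiable (by simp)) hdi]
    simp
  have hreal : ∀ u : ℝ, 𝓕 η u = ((𝓕 η u).re : ℂ) := by
    intro u
    symm
    rw [← Complex.conj_eq_iff_re]
    simp only [Real.fourier_real_eq_integral_exp_smul]
    rw [← integral_conj, ← integral_neg_eq_self]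
    congr 1
    ext v
    have : η (-v) = η v := by simp [η, b.neg]
    simp only [smul_eq_mul, map_mul, this, ← Complex.exp_conj]
    congr 1
    · congr 1
      simp only [Complex.conj_ofReal, Complex.conj_I]
      push_cast
      ring
    · simp [η]
  let S : SchwartzMap ℝ ℂ := hηc.toSchwartzMap hηs
  let H : SchwartzMap ℝ ℂ := 𝓕 S
  have hH : ∀ u, H u = 𝓕 η u := fun u => rfl
  obtain ⟨C, hC0, hC⟩ : ∃ C : ℝ, 0 < C ∧ ∀ u, ‖H u‖ ≤ C := by
    obtain ⟨C, hC0, hC⟩ := H.decay 0 0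
    exact ⟨C, hC0, fun u => by simpa using hC u⟩
  let K : ℝ → ℝ := fun u => (H u).re ^ 2
  have hKcont : Continuous K := (Complex.continuous_re.comp H.continuous).pow 2
  have hKn : ∀ u, 0 ≤ K u := fun u => sq_nonneg _
  have hKb : ∀ u, K u ≤ C * ‖H u‖ := by
    intro u
    have h1 := Complex.abs_re_le_norm (H u)
    have h2 := hC u
    have : K u = |(H u).re| * |(H u).re| := by simp [K, sq]
    rw [this]
    gcongr
    exact h1.trans h2
  have hKi : ∀ k : ℕ, Integrable (fun u : ℝ => |u| ^ k * K u) := by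
    intro k
    refine ((H.integrable_pow_mul volume k).const_mul C).mono' (by fun_prop) ?_
    refine Eventually.of_forall fun u => ?_
    rw [Real.norm_of_nonneg (by have := hKn u; positivity), Real.norm_eq_abs]
    nlinarith [hKb u, pow_nonneg (abs_nonneg u) k]
  have hK0 : Integrable K := by simpa using hKi 0
  have hK2 : Integrable (fun u => u ^ 2 * K u) := by simpa using hKi 2
  have hKpos : 0 < ∫ u, K u := by
    refine integral_pos_of_integrable_nonneg_nonzero hKcont hK0 hKn (x := 0) ?_
    have h0 : H 0 = ((∫ v, b v : ℝ) : ℂ) := by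
      rw [hH, Real.fourier_real_eq_integral_exp_smul]
      simp only [η]
      simp [integral_complex_ofReal]
    simp only [K, h0, Complex.ofReal_re]
    exact pow_ne_zero _ b.integral_pos.ne'
  obtain ⟨c, hc0, hc⟩ : ∃ c : ℝ, 0 < c ∧ 0 < c ^ 2 * (∫ u, K u) - ∫ u, u ^ 2 * K u := by
    refine ⟨(|∫ u, u ^ 2 * K u|) / (∫ u, K u) + 1, by positivity, ?_⟩
    set A := ∫ u, K u
    set B := ∫ u, u ^ 2 * K u
    have h1 : (|B| / A + 1) * A = |B| + A := by field_simp
    have h2 : 0 ≤ |B| / A := by positivity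
    have h3 := le_abs_self B
    nlinarith [mul_nonneg h2 (by positivity : 0 ≤ |B| + A)]
  refine ⟨fun t => (c ^ 2 : ℂ) • (MeasureTheory.convolution η η (ContinuousLinearMap.mul ℂ ℂ) volume) t
      + (1 / (4 * Real.pi ^ 2) : ℂ) •
        (MeasureTheory.convolution (deriv η) (deriv η) (ContinuousLinearMap.mul ℂ ℂ) volume) t,
      fun u => c ^ 2 * K u - u ^ 2 * K u, c, c ^ 2 * C ^ 2, ?_, ?_, ?_, ?_, ?_, hc0, by positivity, ?_, ?_⟩
  · have h1 := hηc.continuous_convolution_right (ContinuousLinearMap.mul ℂ ℂ) hηi.locallyIntegrable hηcont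
    have h2 := hdc.continuous_convolution_right (ContinuousLinearMap.mul ℂ ℂ) hdi.locallyIntegrable hdcont
    exact (h1.const_smul (c ^ 2 : ℂ)).add (h2.const_smul (1 / (4 * Real.pi ^ 2) : ℂ))
  · have h1 := hηc.convolution (ContinuousLinearMap.mul ℂ ℂ) hηc (μ := volume)
    have h2 := hdc.convolution (ContinuousLinearMap.mul ℂ ℂ) hdc (μ := volume)
    exact (h1.smul_left (f := fun _ => (c ^ 2 : ℂ))).add (h2.smul_left (f := fun _ => (1 / (4 * Real.pi ^ 2) : ℂ)))
  · intro u
    have i1 : Integrable (MeasureTheory.convolution η η (ContinuousLinearMap.mul ℂ ℂ) volume) :=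
      hηi.integrable_convolution _ hηi
    have i2 : Integrable (MeasureTheory.convolution (deriv η) (deriv η) (ContinuousLinearMap.mul ℂ ℂ) volume) :=
      hdi.integrable_convolution _ hdi
    have e1 := Real.fourier_mul_convolution_eq hηi hηi u
    have e2 := Real.fourier_mul_convolution_eq hdi hdi u
    rw [hD] at e2
    rw [Real.fourier_eq] at e1 e2 ⊢
    simp only [smul_add]
    rw [integral_add]
    · simp only [smul_comm _ (c ^ 2 : ℂ), smul_comm _ (1 / (4 * Real.pi ^ 2) : ℂ)]
      rw [integral_smul, integral_smul, e1, e2]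
      have : K u = (𝓕 η u).re ^ 2 := by simp only [K, hH]
      rw [this]
      push_cast
      rw [← hreal u]
      have hpi : (Real.pi : ℂ) ≠ 0 := by exact_mod_cast Real.pi_ne_zero
      simp only [smul_eq_mul]
      field_simp
      ring_nf
      rw [Complex.I_sq]
      ring
    · exact (Real.fourierIntegral_convergent_iff u).2 (i1.smul (c ^ 2 : ℂ))
    · exact (Real.fourierIntegral_convergent_iff u).2 (i2.smul (1 / (4 * Real.pi ^ 2) : ℂ))
  · exact (hK0.const_mul _).sub hK2
  · rw [integral_sub (hK0.const_mul _) hK2, integral_const_mul]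
    exact hc
  · intro u
    have h1 := hKb u
    have h2 := hC u
    have h3 : K u ≤ C ^ 2 := by nlinarith
    have h4 : 0 ≤ u ^ 2 * K u := mul_nonneg (sq_nonneg _) (hKn u)
    nlinarith [sq_nonneg c]
  · intro u hu
    have : c ^ 2 ≤ u ^ 2 := by rw [← sq_abs u]; gcongr
    have := mul_le_mul_of_nonneg_right this (hKn u)
    linarith

open ArithmeticFunction in
theorem summable_coeff {σ : ℝ} (hσ : 0 < σ) :
    Summable (fun n : ℕ => vonMangoldt n * (n : ℝ) ^ (-(1 + σ))) := by
  have h := LSeriesSummable_vonMangoldt (s := ((1 + σ : ℝ) : ℂ)) (by simpa using hσ)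
  have h2 := h.norm
  refine h2.congr fun n => ?_
  rcases eq_or_ne n 0 with rfl | hn
  · simp
  · rw [LSeries.norm_term_eq, if_neg hn, Complex.ofReal_re, Complex.norm_real,
      Real.norm_of_nonneg vonMangoldt_nonneg, Real.rpow_neg (Nat.cast_nonneg _), div_eq_mul_inv]

open ArithmeticFunction in
theorem sum_formula {φ : ℝ → ℂ} {f : ℝ → ℝ} (hφi : Integrable φ)
    (hf : ∀ u : ℝ, ∫ t : ℝ, φ t * cexp (-(2 * Real.pi * t * u * I)) = f u) {σ T y : ℝ} (hσ : 0 < σ) :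
    HasSum (fun n : ℕ => ((vonMangoldt n * (n : ℝ) ^ (-(1 + σ)) * f (T * Real.log n - y) : ℝ) : ℂ))
      (∫ t : ℝ, φ t * cexp (2 * Real.pi * t * y * I) *
        LSeries (fun n => (vonMangoldt n : ℂ)) (1 + σ + 2 * Real.pi * T * t * I)) := by
  let F : ℕ → ℝ → ℂ := fun n t => ((vonMangoldt n * (n : ℝ) ^ (-(1 + σ)) : ℝ) : ℂ) *
    (φ t * cexp (-(2 * Real.pi * t * ((T * Real.log n - y : ℝ) : ℂ) * I)))
  have hnorm : ∀ u t : ℝ, ‖φ t * cexp (-(2 * Real.pi * t * (u : ℂ) * I))‖ = ‖φ t‖ := by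
    intro u t
    rw [norm_mul, Complex.norm_exp]
    simp
  have hint : ∀ u : ℝ, Integrable (fun t : ℝ => φ t * cexp (-(2 * Real.pi * t * (u : ℂ) * I))) := by
    intro u
    refine hφi.norm.mono' (hφi.1.mul (by fun_prop)) (Eventually.of_forall fun t => (hnorm u t).le)
  have key := hasSum_integral_of_summable_integral_norm (F := F) (μ := volume)
    (fun n => (hint _).const_mul _) (by
      have : ∀ n, ∫ t, ‖F n t‖ = vonMangoldt n * (n : ℝ) ^ (-(1 + σ)) * ∫ t, ‖φ t‖ := by
        intro n
        rw [← integral_const_mul]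
        congr 1
        ext t
        simp only [F]
        rw [norm_mul, hnorm, Complex.norm_real, Real.norm_of_nonneg]
        exact mul_nonneg vonMangoldt_nonneg (by positivity)
      simp only [this]
      exact (summable_coeff hσ).mul_right _)
  have e1 : (fun n : ℕ => ((vonMangoldt n * (n : ℝ) ^ (-(1 + σ)) * f (T * Real.log n - y) : ℝ) : ℂ))
      = fun n => ∫ t, F n t := by
    ext n
    simp only [F]
    rw [integral_const_mul, hf]
    push_cast
    ring
  have e2 : ∀ t : ℝ, φ t * cexp (2 * Real.pi * t * y * I) *
        LSeries (fun n => (vonMangoldt n : ℂ)) (1 + σ + 2 * Real.pi * T * t * I) = ∑' n, F n t := by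
    intro t
    rw [LSeries, ← tsum_mul_left]
    congr 1
    ext n
    simp only [F]
    rcases eq_or_ne n 0 with rfl | hn
    · simp
    · rw [LSeries.term_of_ne_zero hn]
      have hn' : (n : ℂ) ≠ 0 := by exact_mod_cast hn
      have hn0 : (0 : ℝ) < n := by positivity
      push_cast
      rw [Complex.ofReal_cpow hn0.le, Complex.cpow_def_of_ne_zero hn',
        Complex.cpow_def_of_ne_zero (by simpa using hn'), div_eq_mul_inv, ← Complex.exp_neg]
      simp only [Complex.ofReal_natCast, ← Complex.natCast_log]
      calc _ = φ t * vonMangoldt n * (cexp (2 * Real.pi * t * y * I) *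
            cexp (-(Real.log n * (1 + σ + 2 * Real.pi * T * t * I)))) := by ring
        _ = φ t * vonMangoldt n * (cexp (Real.log n * ((-(1 + σ) : ℝ) : ℂ)) *
            cexp (-(2 * Real.pi * t * (T * Real.log n - y) * I))) := by
          rw [← Complex.exp_add, ← Complex.exp_add]
          congr 2
          push_cast
          ring
        _ = _ := by ring
  rw [e1]
  simp only [e2]
  exact key

theorem pole_formula {φ : ℝ → ℂ} {f : ℝ → ℝ} (hφi : Integrable φ)
    (hf : ∀ u : ℝ, ∫ t : ℝ, φ t * cexp (-(2 * Real.pi * t * u * I)) = f u) {σ T y : ℝ} (hσ : 0 < σ) :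
    ∫ t : ℝ, φ t * cexp (2 * Real.pi * t * y * I) * (1 / (σ + 2 * Real.pi * T * t * I)) =
      ((∫ v in Set.Ioi (0 : ℝ), Real.exp (-σ * v) * f (T * v - y) : ℝ) : ℂ) := by
  have h1 : ∀ t : ℝ, φ t * cexp (2 * Real.pi * t * y * I) * (1 / (σ + 2 * Real.pi * T * t * I)) =
      ∫ v in Set.Ioi (0 : ℝ), φ t * cexp (2 * Real.pi * t * y * I) *
        cexp (-(σ + 2 * Real.pi * T * t * I) * v) := by
    intro t
    rw [integral_const_mul, integral_exp_mul_complex_Ioi (by simpa using hσ)]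
    congr 1
    rw [Complex.ofReal_zero, mul_zero, Complex.exp_zero, neg_div_neg_eq]
  simp only [h1]
  rw [integral_integral_swap, ← integral_complex_ofReal]
  · congr 1
    ext v
    push_cast
    rw [← hf, ← integral_const_mul]
    congr 1
    ext t
    calc _ = φ t * (cexp (2 * Real.pi * t * y * I) *
        cexp (-(σ + 2 * Real.pi * T * t * I) * v)) := by ring
      _ = φ t * (cexp (-σ * v) * cexp (-(2 * Real.pi * t * ((T * v - y : ℝ) : ℂ) * I))) := by
          rw [← Complex.exp_add, ← Complex.exp_add]
          congr 2
          push_cast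
          ring
      _ = _ := by ring
  · have hE : IntegrableOn (fun v : ℝ => Real.exp (-σ * v)) (Set.Ioi 0) :=
      integrableOn_exp_mul_Ioi (by linarith) 0
    have hp := hφi.norm.mul_prod (ν := volume.restrict (Set.Ioi (0:ℝ))) hE
    refine hp.mono' ?_ (Eventually.of_forall fun p => ?_)
    · refine AEStronglyMeasurable.mul (AEStronglyMeasurable.mul hφi.1.comp_fst (by fun_prop)) ?_
      fun_prop
    · simp [Function.uncurry, Complex.norm_exp]

open ArithmeticFunction ArithmeticFunction.vonMangoldt in
theorem exists_regular : ∃ G : ℂ → ℂ, ContinuousOn G {s | 1 ≤ s.re} ∧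
    ∀ s : ℂ, 1 < s.re → LSeries (fun n => (vonMangoldt n : ℂ)) s = G s + 1 / (s - 1) := by
  refine ⟨LFunctionResidueClassAux (1 : ZMod 1), continuousOn_LFunctionResidueClassAux _, ?_⟩
  intro s hs
  have h := eqOn_LFunctionResidueClassAux (q := 1) (a := 1) isUnit_one hs
  rw [h]
  have : (fun n : ℕ => ((residueClass (1 : ZMod 1) n : ℝ) : ℂ)) = fun n => (vonMangoldt n : ℂ) := by
    ext n
    have : (n : ZMod 1) = 1 := Subsingleton.elim _ _
    simp [residueClass, Set.indicator, this]
  simp only [this]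
  simp

open ArithmeticFunction ArithmeticFunction.vonMangoldt in
theorem summable_nonprime :
    Summable fun n : ℕ ↦ (if n.Prime then 0 else vonMangoldt n) / (n : ℝ) := by
  have := summable_residueClass_non_primes_div (1 : ZMod 1)
  refine this.congr fun n => ?_
  have : (n : ZMod 1) = 1 := Subsingleton.elim _ _
  simp [residueClass, Set.indicator, this]

open ArithmeticFunction in
theorem window_ineq {φ : ℝ → ℂ} {f : ℝ → ℝ} {c M : ℝ} (hφc : Continuous φ)
    (hφs : HasCompactSupport φ)
    (hf : ∀ u : ℝ, ∫ t : ℝ, φ t * cexp (-(2 * Real.pi * t * u * I)) = f u)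
    (hfi : Integrable f) (hM0 : 0 < M) (hM : ∀ u, f u ≤ M) (hneg : ∀ u, c ≤ |u| → f u ≤ 0)
    {G : ℂ → ℂ} (hG : ContinuousOn G {s | 1 ≤ s.re})
    (hGL : ∀ s : ℂ, 1 < s.re →
      LSeries (fun n => (vonMangoldt n : ℂ)) s = G s + 1 / (s - 1)) {T y : ℝ} (hT : 0 < T)
    (W : Finset ℕ) (hW : ∀ n : ℕ, 1 ≤ n → |T * Real.log n - y| < c → n ∈ W) :
    (∫ t : ℝ, φ t * cexp (2 * Real.pi * t * y * I) * G (1 + 2 * Real.pi * T * t * I)).re +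
      ∫ v in Set.Ioi (0 : ℝ), f (T * v - y) ≤ M * ∑ n ∈ W, vonMangoldt n / n := by
  have hφi : Integrable φ := hφc.integrable_of_hasCompactSupport hφs
  let P : ℝ → ℝ → ℂ := fun σ t =>
    φ t * cexp (2 * Real.pi * t * y * I) * G (1 + σ + 2 * Real.pi * T * t * I)
  have hPc : ContinuousOn P.uncurry (Set.Ici 0 ×ˢ Set.univ) := by
    refine ContinuousOn.mul (by fun_prop) ?_
    refine hG.comp (by fun_prop) ?_
    rintro ⟨σ, t⟩ ⟨h, -⟩
    simpa using h
  have hPi : ∀ σ : ℝ, 0 ≤ σ → Integrable (P σ) := by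
    intro σ hσ
    refine Continuous.integrable_of_hasCompactSupport ?_ ?_
    · rw [← continuousOn_univ]
      exact hPc.comp (f := fun t => (σ, t)) (by fun_prop) (fun t _ => ⟨hσ, trivial⟩)
    · exact (hφs.mul_right).mul_right
  have hlim1 : Tendsto (fun σ => (∫ t, P σ t).re) (𝓝[>] 0) (𝓝 (∫ t, P 0 t).re) := by
    have := continuousOn_integral_of_compact_support (μ := volume) (f := P) (s := Set.Ici 0) hφs hPc
      (fun p x _ hx => by simp [P, image_eq_zero_of_notMem_tsupport hx])
    have h0 := (this 0 (by simp)).tendsto.mono_left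
      (nhdsWithin_mono _ (Set.Ioi_subset_Ici le_rfl))
    exact (Complex.continuous_re.tendsto _).comp h0
  have hfTi : Integrable (fun v : ℝ => f (T * v - y)) :=
    (hfi.comp_sub_right y).comp_mul_left' hT.ne'
  have hlim2 : Tendsto (fun σ : ℝ => ∫ v in Set.Ioi (0 : ℝ), Real.exp (-σ * v) * f (T * v - y))
      (𝓝[>] 0) (𝓝 (∫ v in Set.Ioi (0 : ℝ), f (T * v - y))) := by
    refine tendsto_integral_filter_of_dominated_convergence (fun v => ‖f (T * v - y)‖) ?_ ?_
      hfTi.norm.integrableOn ?_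
    · refine Eventually.of_forall fun σ => ?_
      exact AEStronglyMeasurable.mul (by fun_prop) hfTi.1.restrict
    · filter_upwards [self_mem_nhdsWithin] with σ hσ
      refine (ae_restrict_iff' measurableSet_Ioi).2 (Eventually.of_forall fun v hv => ?_)
      rw [norm_mul, Real.norm_of_nonneg (Real.exp_pos _).le]
      refine mul_le_of_le_one_left (norm_nonneg _) ?_
      rw [Real.exp_le_one_iff]
      have := mul_pos (Set.mem_Ioi.1 hσ) (Set.mem_Ioi.1 hv)
      linarith
    · refine Eventually.of_forall fun v => ?_
      have : Continuous (fun σ : ℝ => Real.exp (-σ * v) * f (T * v - y)) := by fun_prop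
      have h := this.tendsto 0
      simp only [neg_zero, zero_mul, Real.exp_zero, one_mul] at h
      exact h.mono_left nhdsWithin_le_nhds
  have hP0 : (∫ t : ℝ, φ t * cexp (2 * Real.pi * t * y * I) * G (1 + 2 * Real.pi * T * t * I)) =
      ∫ t, P 0 t := by simp [P]
  rw [hP0]
  refine le_of_tendsto (hlim1.add hlim2) ?_
  filter_upwards [self_mem_nhdsWithin] with σ hσ
  replace hσ : 0 < σ := hσ
  have hsum := sum_formula hφi hf (T := T) (y := y) hσ
  have hpole := pole_formula hφi hf (T := T) (y := y) hσ
  have hsplit : (∫ t : ℝ, φ t * cexp (2 * Real.pi * t * y * I) *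
        LSeries (fun n => (vonMangoldt n : ℂ)) (1 + σ + 2 * Real.pi * T * t * I)) =
      (∫ t, P σ t) + ∫ t : ℝ, φ t * cexp (2 * Real.pi * t * y * I) *
        (1 / (σ + 2 * Real.pi * T * t * I)) := by
    rw [← integral_add (hPi σ hσ.le)]
    · congr 1
      ext t
      rw [hGL _ (by simpa using hσ)]
      simp only [P]
      rw [mul_add]
      congr 4
      ring
    · refine Continuous.integrable_of_hasCompactSupport ?_ ?_
      · refine Continuous.mul (by fun_prop) (Continuous.div continuous_const (by fun_prop) ?_)
        intro t h
        have := congrArg Complex.re h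
        simp at this
        exact hσ.ne' this
      · exact (hφs.mul_right).mul_right
  rw [hsplit, hpole] at hsum
  have hre := Complex.hasSum_re hsum
  simp only [Complex.ofReal_re, Complex.add_re] at hre
  have hfin := hasSum_sum_of_ne_finset_zero (L := SummationFilter.unconditional ℕ) (s := W)
    (f := fun n : ℕ => if n ∈ W then M * (vonMangoldt n / n) else 0) (fun n hn => by simp [hn])
  refine (hasSum_le (fun n => ?_) hre hfin).trans_eq ?_
  · have hL : 0 ≤ vonMangoldt n := vonMangoldt_nonneg
    rcases Nat.eq_zero_or_pos n with rfl | hn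
    · simp
    have hn1 : (1 : ℝ) ≤ n := by exact_mod_cast hn
    have hpos : 0 ≤ vonMangoldt n * (n : ℝ) ^ (-(1 + σ)) := by positivity
    split_ifs with h
    · have h1 : (n : ℝ) ^ (-(1 + σ)) ≤ (n : ℝ)⁻¹ := by
        rw [← Real.rpow_neg_one]
        exact Real.rpow_le_rpow_of_exponent_le hn1 (by linarith)
      calc _ ≤ vonMangoldt n * (n : ℝ) ^ (-(1 + σ)) * M := by gcongr; exact hM _
        _ ≤ vonMangoldt n * (n : ℝ)⁻¹ * M := by gcongr
        _ = _ := by ring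
    · refine mul_nonpos_of_nonneg_of_nonpos hpos (hneg _ ?_)
      by_contra hlt
      exact h (hW n hn (not_le.1 hlt))
  · rw [Finset.mul_sum]
    exact Finset.sum_congr rfl fun n hn => by simp [hn]

open ArithmeticFunction in
theorem window_lower {δ : ℝ} (hδ : 0 < δ) : ∃ κ : ℝ, 0 < κ ∧ ∀ᶠ L : ℝ in atTop, ∀ W : Finset ℕ,
    (∀ n : ℕ, 1 ≤ n → |Real.log n - L| < δ → n ∈ W) → κ ≤ ∑ n ∈ W, vonMangoldt n / n := by
  obtain ⟨φ, f, c, M, hφc, hφs, hFf, hfi, hfpos, hc, hM0, hM, hneg⟩ := kernel_exists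
  obtain ⟨G, hG, hGL⟩ := exists_regular
  have hf : ∀ u : ℝ, ∫ t : ℝ, φ t * cexp (-(2 * Real.pi * t * u * I)) = f u := by
    intro u
    rw [← hFf, Real.fourier_real_eq_integral_exp_smul]
    congr 1
    ext t
    rw [smul_eq_mul, mul_comm]
    congr 2
    push_cast
    ring
  let T := c / δ
  have hT : 0 < T := div_pos hc hδ
  have hy : Tendsto (fun L : ℝ => T * L) atTop atTop := tendsto_id.const_mul_atTop hT
  -- Riemann-Lebesgue
  have hRL : Tendsto (fun y : ℝ => (∫ t : ℝ, φ t * cexp (2 * Real.pi * t * y * I) *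
      G (1 + 2 * Real.pi * T * t * I)).re) atTop (𝓝 0) := by
    have h := (Real.zero_at_infty_fourier
      (fun t : ℝ => φ t * G (1 + 2 * Real.pi * T * t * I))).mono_left atBot_le_cocompact
    have h2 := (Complex.continuous_re.tendsto 0).comp (h.comp tendsto_neg_atTop_atBot)
    refine h2.congr fun y => ?_
    simp only [Function.comp_apply]
    rw [Real.fourier_real_eq_integral_exp_smul]
    congr 2
    ext t
    rw [smul_eq_mul]
    have : ((-2 * Real.pi * t * -y : ℝ) : ℂ) * I = 2 * Real.pi * t * y * I := by
      push_cast; ring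
    rw [this]
    ring
  have hI : Tendsto (fun L : ℝ => ∫ v in Set.Ioi (0 : ℝ), f (T * v - T * L)) atTop
      (𝓝 (∫ v, f (T * v))) := by
    have e : ∀ L : ℝ, ∫ v in Set.Ioi (0 : ℝ), f (T * v - T * L) =
        ∫ v, (Set.Ioi (-L)).indicator (fun v => f (T * v)) v := by
      intro L
      rw [← integral_indicator measurableSet_Ioi, ← integral_add_right_eq_self _ L]
      congr 1
      ext v
      simp only [Set.indicator, Set.mem_Ioi]
      have : (0 < v + L) ↔ (-L < v) := by constructor <;> intro h <;> linarith
      simp only [this]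
      congr 2
      ring
    simp only [e]
    have hfT : Integrable (fun v => f (T * v)) := hfi.comp_mul_left' hT.ne'
    refine tendsto_integral_filter_of_dominated_convergence (fun v => ‖f (T * v)‖) ?_ ?_ hfT.norm ?_
    · exact Eventually.of_forall fun L => hfT.1.indicator measurableSet_Ioi
    · exact Eventually.of_forall fun L => Eventually.of_forall fun v =>
        norm_indicator_le_norm_self _ _
    · refine Eventually.of_forall fun v => ?_
      refine tendsto_const_nhds.congr' ?_
      filter_upwards [eventually_gt_atTop (-v)] with L hL
      rw [Set.indicator_of_mem]
      exact Set.mem_Ioi.2 (by linarith)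
  have hA : 0 < ∫ v, f (T * v) := by
    rw [Measure.integral_comp_mul_left, smul_eq_mul]
    positivity
  set A := ∫ v, f (T * v)
  have hsum := (hRL.comp hy).add hI
  rw [zero_add] at hsum
  refine ⟨A / 2 / M, by positivity, ?_⟩
  filter_upwards [hsum.eventually (lt_mem_nhds (half_lt_self hA))] with L hL W hW
  rw [div_le_iff₀' hM0]
  refine hL.le.trans (window_ineq hφc hφs hf hfi hM0 hM hneg hG hGL hT W fun n hn h => hW n hn ?_)
  rw [← mul_sub, abs_mul, abs_of_pos hT] at h
  have : T * δ = c := by simp only [T]; field_simp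
  rw [← this] at h
  exact lt_of_mul_lt_mul_left h hT.le

/-- For every positive integer `r`, the set `A_r = ⋃_{p prime} [r·p, (r+1)·p)` is
cofinite in `ℕ`: its complement, the set of `n` for which no prime `p` satisfies
`r·p ≤ n < (r+1)·p` (equivalently `n/(r+1) < p ≤ n/r`), is finite. -/
theorem Ar_cofinite (r : ℕ) (hr : 1 ≤ r) :
    ({n : ℕ | ∃ p : ℕ, p.Prime ∧ r * p ≤ n ∧ n < (r + 1) * p}ᶜ).Finite := by
  have hr0 : (0 : ℝ) < r := by exact_mod_cast hr
  have hlt : Real.log r < Real.log (r + 1) := Real.log_lt_log hr0 (by linarith)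
  obtain ⟨κ, hκ, hev⟩ := window_lower (δ := (Real.log (r + 1) - Real.log r) / 2) (by linarith)
  obtain ⟨s, hs⟩ := (summable_iff_vanishing_norm.1 summable_nonprime) κ hκ
  have htend : Tendsto (fun n : ℕ => Real.log n - (Real.log (r + 1) + Real.log r) / 2)
      atTop atTop :=
    tendsto_atTop_add_const_right _ _ (Real.tendsto_log_atTop.comp tendsto_natCast_atTop_atTop)
  have hmain : ∀ᶠ n : ℕ in atTop, ∃ p : ℕ, p.Prime ∧ r * p ≤ n ∧ n < (r + 1) * p := by
    filter_upwards [htend.eventually hev, eventually_ge_atTop 1,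
      eventually_ge_atTop ((r + 1) * (s.sup id))] with n hn hn1 hns
    let W := (Finset.range (n + 1)).filter (fun m => r * m ≤ n ∧ n < (r + 1) * m)
    have hW := hn W (by
      intro m hm h
      rw [abs_lt] at h
      have hm0 : (0 : ℝ) < m := by exact_mod_cast hm
      have hn0 : (0 : ℝ) < n := by exact_mod_cast hn1
      have h1 : Real.log (r * m) < Real.log n := by
        rw [Real.log_mul hr0.ne' hm0.ne']; linarith [h.2]
      have h2 : Real.log n < Real.log ((r + 1) * m) := by
        rw [Real.log_mul (by positivity) hm0.ne']; linarith [h.1]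
      rw [Real.log_lt_log_iff (by positivity) (by positivity)] at h1 h2
      have h1' : r * m < n := by exact_mod_cast h1
      have h2' : n < (r + 1) * m := by exact_mod_cast h2
      simp only [W, Finset.mem_filter, Finset.mem_range]
      refine ⟨?_, h1'.le, h2'⟩
      nlinarith)
    by_contra hno
    push Not at hno
    have hdis : Disjoint W s := by
      rw [Finset.disjoint_left]
      intro m hm hms
      simp only [W, Finset.mem_filter] at hm
      have : m ≤ s.sup id := Finset.le_sup (f := id) hms
      have := Nat.mul_le_mul_left (r + 1) this
      omega
    have hlt := hs W hdis
    have heq : ∑ m ∈ W, (if m.Prime then 0 else ArithmeticFunction.vonMangoldt m) / (m : ℝ) =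
        ∑ m ∈ W, ArithmeticFunction.vonMangoldt m / (m : ℝ) := by
      refine Finset.sum_congr rfl fun m hm => ?_
      simp only [W, Finset.mem_filter] at hm
      rw [if_neg]
      intro hp
      have := hno m hp hm.2.1
      omega
    rw [heq] at hlt
    have := (le_abs_self _).trans_lt (by simpa only [Real.norm_eq_abs] using hlt)
    linarith
  rw [← Nat.cofinite_eq_atTop] at hmain
  exact hmain
end

section
/- For every integer r with 2 ≤ r ≤ 29 and every integer n ≥ 331·r, there exists a prime p with n/(r+1) < p ≤ n/r (i.e., n ∈ A_r). -/
open Finset in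
/-- `log N! = ∑_{n ≤ N} Λ(n) ⌊N/n⌋`. -/
lemma log_factorial_eq (N : ℕ) :
    Real.log (N.factorial : ℝ) =
      ∑ n ∈ Ioc 0 N, ArithmeticFunction.vonMangoldt n * ((N / n : ℕ) : ℝ) := by
  have h1 : Real.log (N.factorial : ℝ) = ∑ k ∈ Ioc 0 N, Real.log (k : ℝ) := by
    induction N with
    | zero => simp
    | succ n ih =>
      rw [Nat.factorial_succ, Nat.cast_mul, Real.log_mul (by positivity) (by positivity), ih,
        Finset.sum_Ioc_succ_top (by omega)]
      ring
  have h2 : ∀ k ∈ Ioc 0 N, Real.log (k : ℝ) =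
      ∑ n ∈ Ioc 0 N, if n ∣ k then ArithmeticFunction.vonMangoldt n else 0 := by
    intro k hk
    rw [Finset.mem_Ioc] at hk
    rw [← ArithmeticFunction.vonMangoldt_sum, ← Finset.sum_filter]
    apply Finset.sum_congr _ (fun _ _ => rfl)
    ext n
    simp only [Nat.mem_divisors, Finset.mem_filter, Finset.mem_Ioc]
    constructor
    · rintro ⟨h, _⟩
      exact ⟨⟨Nat.pos_of_dvd_of_pos h hk.1, (Nat.le_of_dvd hk.1 h).trans hk.2⟩, h⟩
    · rintro ⟨_, h⟩
      exact ⟨h, by omega⟩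
  rw [h1, Finset.sum_congr rfl h2, Finset.sum_comm]
  apply Finset.sum_congr rfl
  intro n _
  rw [← Finset.sum_filter, Finset.sum_const, Nat.Ioc_filter_dvd_card_eq_div, nsmul_eq_mul, mul_comm]

/-- The combination `log N! - d log (N/d)!`. -/
noncomputable def gD (N d : ℕ) : ℝ :=
  Real.log (N.factorial : ℝ) - d * Real.log ((N / d).factorial : ℝ)

open Finset in
lemma gD_eq (N d : ℕ) :
    gD N d = ∑ n ∈ Ioc 0 N, ArithmeticFunction.vonMangoldt n * (((N / n) % d : ℕ) : ℝ) := by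
  have h : Real.log ((N / d).factorial : ℝ) =
      ∑ n ∈ Ioc 0 N, ArithmeticFunction.vonMangoldt n * ((N / n / d : ℕ) : ℝ) := by
    rw [log_factorial_eq]
    have hs : Ioc 0 (N / d) ⊆ Ioc 0 N :=
      Finset.Ioc_subset_Ioc_right (Nat.div_le_self N d)
    rw [← Finset.sum_subset hs]
    · apply Finset.sum_congr rfl
      intro n _
      rw [Nat.div_div_eq_div_mul, Nat.div_div_eq_div_mul, mul_comm d n]
    · intro n hn hn'
      simp only [Finset.mem_Ioc, not_and, not_le] at hn hn'
      have := hn' hn.1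
      have h0 : N / n / d = 0 := by
        rw [Nat.div_div_eq_div_mul, mul_comm, ← Nat.div_div_eq_div_mul]
        exact Nat.div_eq_of_lt this
      simp [h0]
  rw [gD, h, log_factorial_eq, Finset.mul_sum, ← Finset.sum_sub_distrib]
  apply Finset.sum_congr rfl
  intro n _
  have : ((N / n : ℕ) : ℝ) = ((N / n % d : ℕ) : ℝ) + (d : ℝ) * ((N / n / d : ℕ) : ℝ) := by
    exact_mod_cast (Nat.mod_add_div (N / n) d).symm
  rw [this]; ring

open Finset in
lemma psi_div_eq (x : ℝ) (J : ℕ) (hJ : 1 ≤ J) :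
    Chebyshev.psi (x / J) = ∑ n ∈ Ioc 0 ⌊x⌋₊,
      ArithmeticFunction.vonMangoldt n * ((1 - (J - ⌊x⌋₊ / n) : ℕ) : ℝ) := by
  rw [Chebyshev.psi, Nat.floor_div_natCast]
  have hs : Ioc 0 (⌊x⌋₊ / J) ⊆ Ioc 0 ⌊x⌋₊ :=
    Finset.Ioc_subset_Ioc_right (Nat.div_le_self _ _)
  rw [← Finset.sum_subset hs (f := fun n => ArithmeticFunction.vonMangoldt n *
    ((1 - (J - ⌊x⌋₊ / n) : ℕ) : ℝ))]
  · apply Finset.sum_congr rfl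
    intro n hn
    rw [Finset.mem_Ioc] at hn
    have : J ≤ ⌊x⌋₊ / n := by
      rw [Nat.le_div_iff_mul_le hn.1, mul_comm]
      exact (Nat.le_div_iff_mul_le (by omega)).1 hn.2
    have h0 : 1 - (J - ⌊x⌋₊ / n) = 1 := by omega
    simp [h0]
  · intro n hn hn'
    simp only [Finset.mem_Ioc, not_and, not_le] at hn hn'
    have h2 := hn' hn.1
    have : ⌊x⌋₊ / n < J := by
      rw [Nat.div_lt_iff_lt_mul hn.1, mul_comm]
      exact (Nat.div_lt_iff_lt_mul (by omega)).1 h2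
    have h0 : 1 - (J - ⌊x⌋₊ / n) = 0 := by omega
    simp [h0]

/-- Stirling-type bound. -/
lemma log_factorial_bounds (n : ℕ) (hn : 1 ≤ n) :
    n * Real.log n - n + 1 ≤ Real.log (n.factorial : ℝ) ∧
    Real.log (n.factorial : ℝ) ≤ n * Real.log n - n + 1 + Real.log n := by
  induction n, hn using Nat.le_induction with
  | base => simp
  | succ n hn ih =>
    obtain ⟨h1, h2⟩ := ih
    have hn0 : (0 : ℝ) < n := by exact_mod_cast hn
    rw [Nat.factorial_succ, Nat.cast_mul, Real.log_mul (by positivity) (by positivity)]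
    push_cast
    -- with L = log (n+1) - log n : 1/(n+1) ≤ L ≤ 1/n
    have hu : Real.log ((n : ℝ) + 1) - Real.log n ≤ 1 / n := by
      rw [← Real.log_div (by positivity) (by positivity)]
      have := Real.log_le_sub_one_of_pos (x := ((n : ℝ) + 1) / n) (by positivity)
      have e : ((n : ℝ) + 1) / n - 1 = 1 / n := by field_simp; ring
      linarith
    have hl : 1 / ((n : ℝ) + 1) ≤ Real.log ((n : ℝ) + 1) - Real.log n := by
      rw [← Real.log_div (by positivity) (by positivity)]
      have := Real.one_sub_inv_le_log_of_pos (x := ((n : ℝ) + 1) / n) (by positivity)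
      have e : 1 - (((n : ℝ) + 1) / n)⁻¹ = 1 / ((n : ℝ) + 1) := by field_simp; ring
      linarith
    have hu' : n * (Real.log ((n : ℝ) + 1) - Real.log n) ≤ 1 := by
      have := mul_le_mul_of_nonneg_left hu hn0.le
      rwa [mul_one_div_cancel hn0.ne'] at this
    have hl' : 1 ≤ ((n : ℝ) + 1) * (Real.log ((n : ℝ) + 1) - Real.log n) := by
      have := mul_le_mul_of_nonneg_left hl (by positivity : (0 : ℝ) ≤ (n : ℝ) + 1)
      rwa [mul_one_div_cancel (by positivity)] at this
    constructor <;> nlinarith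

/-- `x log x - x` is monotone on `[1, ∞)`. -/
lemma xlogx_mono {x y : ℝ} (hx : 1 ≤ x) (hxy : x ≤ y) :
    x * Real.log x - x ≤ y * Real.log y - y := by
  have hx0 : 0 < x := by linarith
  have hy0 : 0 < y := by linarith
  have h := Real.log_le_sub_one_of_pos (x := x / y) (by positivity)
  rw [Real.log_div hx0.ne' hy0.ne'] at h
  have h2 : y * (Real.log x - Real.log y) ≤ x - y := by
    have := mul_le_mul_of_nonneg_left h hy0.le
    have e : y * (x / y - 1) = x - y := by field_simp
    linarith
  have h3 : 0 ≤ Real.log x := Real.log_nonneg hx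
  nlinarith

lemma log_factorial_floor (x : ℝ) (hx : 1 ≤ x) :
    |Real.log ((⌊x⌋₊).factorial : ℝ) - (x * Real.log x - x)| ≤ 1 + Real.log (x + 1) := by
  set n := ⌊x⌋₊ with hn
  have hn1 : 1 ≤ n := Nat.one_le_floor_iff x |>.2 hx
  have hnx : (n : ℝ) ≤ x := Nat.floor_le (by linarith)
  have hxn : x < n + 1 := Nat.lt_floor_add_one x
  have hnr : (1 : ℝ) ≤ n := by exact_mod_cast hn1
  obtain ⟨_, h2⟩ := log_factorial_bounds n hn1
  obtain ⟨h3, _⟩ := log_factorial_bounds (n + 1) (by omega)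
  rw [Nat.factorial_succ, Nat.cast_mul, Real.log_mul (by positivity) (by positivity)] at h3
  push_cast at h3
  have m1 := xlogx_mono hnr hnx
  have m2 := xlogx_mono hx hxn.le
  have l1 : Real.log n ≤ Real.log (x + 1) := Real.log_le_log (by linarith) (by linarith)
  have l2 : Real.log (n + 1) ≤ Real.log (x + 1) := Real.log_le_log (by linarith) (by linarith)
  rw [abs_le]
  constructor <;> linarith

lemma gD_approx (x : ℝ) (d : ℕ) (hd : 1 ≤ d) (hx : (d : ℝ) ≤ x) :
    |gD ⌊x⌋₊ d - x * Real.log d| ≤ (d + 1) * (1 + Real.log (x + 1)) := by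
  have hd' : (1 : ℝ) ≤ d := by exact_mod_cast hd
  have hd0 : (0 : ℝ) < d := by linarith
  have hx1 : 1 ≤ x := by linarith
  have h1 := log_factorial_floor x hx1
  have h2 := log_factorial_floor (x / d) (by rw [le_div_iff₀ hd0]; linarith)
  rw [Nat.floor_div_natCast, Real.log_div (by linarith) hd0.ne'] at h2
  have l1 : Real.log (x / d + 1) ≤ Real.log (x + 1) := by
    apply Real.log_le_log (by positivity)
    have : x / d ≤ x := div_le_self (by linarith) hd'
    linarith
  have h3 : |(d : ℝ) * Real.log ((⌊x⌋₊ / d).factorial : ℝ) -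
      (x * (Real.log x - Real.log d) - x)| ≤ d * (1 + Real.log (x + 1)) := by
    have e : (d : ℝ) * Real.log ((⌊x⌋₊ / d).factorial : ℝ) -
      (x * (Real.log x - Real.log d) - x) = d * (Real.log ((⌊x⌋₊ / d).factorial : ℝ) -
        (x / d * (Real.log x - Real.log d) - x / d)) := by
      field_simp
    rw [e, abs_mul, abs_of_pos hd0]
    exact mul_le_mul_of_nonneg_left (h2.trans (by linarith)) hd0.le
  rw [gD]
  rw [abs_le] at h1 h3 ⊢
  constructor <;> nlinarith [h1.1, h1.2, h3.1, h3.2]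


/-- `∑ m * (y mod d)` over the list of pairs `(d, m)`. -/
def wS : List (ℕ × ℕ) → ℕ → ℕ
  | [], _ => 0
  | h :: t, y => Nat.add (Nat.mul h.2 (Nat.mod y h.1)) (wS t y)

/-- `∑ z * [J ≤ y]` over the list of pairs `(J, z)`. -/
def wZ : List (ℕ × ℕ) → ℕ → ℕ
  | [], _ => 0
  | h :: t, y => Nat.add (Nat.mul h.2 (Nat.sub 1 (Nat.sub h.1 y))) (wZ t y)

lemma wS_cons (h : ℕ × ℕ) (t : List (ℕ × ℕ)) (y : ℕ) :
    wS (h :: t) y = h.2 * (y % h.1) + wS t y := rfl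

lemma wZ_cons (h : ℕ × ℕ) (t : List (ℕ × ℕ)) (y : ℕ) :
    wZ (h :: t) y = h.2 * (1 - (h.1 - y)) + wZ t y := rfl

/-- Bisection for `⌊log₂ (d ^ 65536)⌋`; its correctness is checked where it is used. -/
noncomputable def lg (d : ℕ) : ℕ :=
  Nat.rec (motive := fun _ => ℕ → ℕ) (fun acc => acc) (fun i ih acc =>
    ih (cond (Nat.ble (Nat.pow 2 (Nat.add acc (Nat.pow 2 i))) (Nat.pow d 65536))
      (Nat.add acc (Nat.pow 2 i)) acc)) 19 0

/-- Correctness check for `lg` on a list. -/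
noncomputable def okLg : List (ℕ × ℕ) → Bool
  | [] => true
  | h :: t => Nat.ble (Nat.pow 2 (lg h.1)) (Nat.pow h.1 65536) &&
      Nat.ble (Nat.pow h.1 65536) (Nat.pow 2 (lg h.1 + 1)) && okLg t

lemma okLg_cons {h : ℕ × ℕ} {t : List (ℕ × ℕ)} (H : okLg (h :: t) = true) :
    2 ^ lg h.1 ≤ h.1 ^ 65536 ∧ h.1 ^ 65536 ≤ 2 ^ (lg h.1 + 1) ∧ okLg t = true := by
  rw [okLg, Bool.and_eq_true, Bool.and_eq_true, Nat.ble_eq, Nat.ble_eq] at H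
  exact ⟨H.1.1, H.1.2, H.2⟩

/-- Integer upper estimate for `65536 * log d / log 2`, weighted. -/
noncomputable def sumUp : List (ℕ × ℕ) → ℕ
  | [] => 0
  | h :: t => h.2 * (lg h.1 + 1) + sumUp t

noncomputable def sumDn : List (ℕ × ℕ) → ℕ
  | [] => 0
  | h :: t => h.2 * lg h.1 + sumDn t

/-- Upper estimate for `10000 * ∑ z / J`. -/
def invUp : List (ℕ × ℕ) → ℕ
  | [] => 0
  | h :: t => (h.2 * 10000 / h.1 + 1) + invUp t

def invDn : List (ℕ × ℕ) → ℕ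
  | [] => 0
  | h :: t => h.2 * 10000 / h.1 + invDn t

def errS : List (ℕ × ℕ) → ℕ
  | [] => 0
  | h :: t => h.2 * (h.1 + 1) + errS t

def maxS : List (ℕ × ℕ) → ℕ
  | [] => 0
  | h :: t => h.2 * (h.1 - 1) + maxS t

def totZ : List (ℕ × ℕ) → ℕ
  | [] => 0
  | h :: t => h.2 + totZ t

/-- All first components lie in `[1, Y]`. -/
def okL (Y : ℕ) : List (ℕ × ℕ) → Bool
  | [] => true
  | h :: t => Nat.ble 1 h.1 && Nat.ble h.1 Y && okL Y t

lemma okL_cons {Y : ℕ} {h : ℕ × ℕ} {t : List (ℕ × ℕ)} (H : okL Y (h :: t) = true) :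
    1 ≤ h.1 ∧ h.1 ≤ Y ∧ okL Y t = true := by
  simp only [okL, Bool.and_eq_true, Nat.ble_eq] at H
  exact ⟨H.1.1, H.1.2, H.2⟩

lemma wS_le_max {Y : ℕ} (L : List (ℕ × ℕ)) (H : okL Y L = true) (y : ℕ) : wS L y ≤ maxS L := by
  induction L with
  | nil => exact le_rfl
  | cons h t ih =>
    obtain ⟨h1, _, h3⟩ := okL_cons H
    rw [wS_cons, maxS]
    have : y % h.1 ≤ h.1 - 1 := by have := Nat.mod_lt y (by omega : h.1 > 0); omega
    exact Nat.add_le_add (Nat.mul_le_mul_left _ this) (ih h3)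

lemma wZ_le_tot (L : List (ℕ × ℕ)) (y : ℕ) : wZ L y ≤ totZ L := by
  induction L with
  | nil => exact le_rfl
  | cons h t ih =>
    rw [wZ_cons, totZ]
    have : 1 - (h.1 - y) ≤ 1 := by omega
    have := Nat.mul_le_mul_left h.2 this
    omega

lemma wZ_eq_tot {Y : ℕ} (L : List (ℕ × ℕ)) (H : okL Y L = true) (y : ℕ) (hy : Y ≤ y) :
    wZ L y = totZ L := by
  induction L with
  | nil => rfl
  | cons h t ih =>
    obtain ⟨_, h2, h3⟩ := okL_cons H
    rw [wZ_cons, totZ, ih h3]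
    have : 1 - (h.1 - y) = 1 := by omega
    rw [this, mul_one]

open Finset in
/-- `∑ Λ(n) wS L ⌊x/n⌋` as a combination of factorials. -/
lemma sum_wS_le {Y : ℕ} (L : List (ℕ × ℕ)) (H : okL Y L = true) (H' : okLg L = true)
    (x : ℝ) (hx : (Y : ℝ) ≤ x)
    (hx1 : 1 ≤ x) :
    (∑ n ∈ Ioc 0 ⌊x⌋₊, ArithmeticFunction.vonMangoldt n * (wS L (⌊x⌋₊ / n) : ℝ) ≤
      x * (sumUp L * (Real.log 2 / 65536)) + errS L * (1 + Real.log (x + 1))) ∧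
    (x * (sumDn L * (Real.log 2 / 65536)) - errS L * (1 + Real.log (x + 1)) ≤
      ∑ n ∈ Ioc 0 ⌊x⌋₊, ArithmeticFunction.vonMangoldt n * (wS L (⌊x⌋₊ / n) : ℝ)) := by
  induction L with
  | nil => simp [wS, sumUp, sumDn, errS]
  | cons h t ih =>
    obtain ⟨h1, h2, h3⟩ := okL_cons H
    obtain ⟨g1, g2, g3⟩ := okLg_cons H'
    obtain ⟨iu, il⟩ := ih h3 g3
    have e : ∑ n ∈ Ioc 0 ⌊x⌋₊, ArithmeticFunction.vonMangoldt n * (wS (h :: t) (⌊x⌋₊ / n) : ℝ) =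
        h.2 * gD ⌊x⌋₊ h.1 +
        ∑ n ∈ Ioc 0 ⌊x⌋₊, ArithmeticFunction.vonMangoldt n * (wS t (⌊x⌋₊ / n) : ℝ) := by
      rw [gD_eq, Finset.mul_sum, ← Finset.sum_add_distrib]
      apply Finset.sum_congr rfl
      intro n _
      rw [wS_cons]; push_cast; ring
    have hdx : (h.1 : ℝ) ≤ x := le_trans (by exact_mod_cast h2) hx
    have ha := gD_approx x h.1 h1 hdx
    have hd0 : (0 : ℝ) < h.1 := by exact_mod_cast h1
    have hl1 : (lg h.1 : ℝ) * Real.log 2 ≤ 65536 * Real.log h.1 := by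
      have h' : (2 : ℝ) ^ (lg h.1) ≤ (h.1 : ℝ) ^ 65536 := by exact_mod_cast g1
      have := Real.log_le_log (by positivity) h'
      rw [Real.log_pow, Real.log_pow] at this
      exact_mod_cast this
    have hl2 : 65536 * Real.log h.1 ≤ (lg h.1 + 1 : ℝ) * Real.log 2 := by
      have h' : (h.1 : ℝ) ^ 65536 ≤ (2 : ℝ) ^ (lg h.1 + 1) := by exact_mod_cast g2
      have := Real.log_le_log (by positivity) h'
      rw [Real.log_pow, Real.log_pow] at this
      exact_mod_cast this
    rw [e, sumUp, sumDn, errS]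
    clear g1 g2
    generalize lg h.1 = l at *
    push_cast
    have hx0 : 0 ≤ x := by linarith
    have hm : (0 : ℝ) ≤ h.2 := Nat.cast_nonneg _
    rw [abs_le] at ha
    have hm1 := mul_le_mul_of_nonneg_left ha.1 hm
    have hm2 := mul_le_mul_of_nonneg_left ha.2 hm
    have hmx : (0 : ℝ) ≤ h.2 * x := by positivity
    have hk1 := mul_le_mul_of_nonneg_left hl1 hmx
    have hk2 := mul_le_mul_of_nonneg_left hl2 hmx
    constructor <;> linarith

open Finset in
lemma sum_wZ_le {Y : ℕ} (L : List (ℕ × ℕ)) (H : okL Y L = true) (a b X x : ℝ)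
    (hab : ∀ t, X ≤ t → a * t ≤ Chebyshev.psi t ∧ Chebyshev.psi t ≤ b * t)
    (ha : 0 ≤ a) (hb : 0 ≤ b) (hX : 0 ≤ X) (hx : Y * X ≤ x) (hx0 : 0 ≤ x) :
    (∑ n ∈ Ioc 0 ⌊x⌋₊, ArithmeticFunction.vonMangoldt n * (wZ L (⌊x⌋₊ / n) : ℝ) ≤
      x * (b * (invUp L / 10000))) ∧
    (x * (a * (invDn L / 10000)) ≤
      ∑ n ∈ Ioc 0 ⌊x⌋₊, ArithmeticFunction.vonMangoldt n * (wZ L (⌊x⌋₊ / n) : ℝ)) := by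
  induction L with
  | nil => simp [wZ, invUp, invDn]
  | cons h t ih =>
    obtain ⟨h1, h2, h3⟩ := okL_cons H
    obtain ⟨iu, il⟩ := ih h3
    have e : ∑ n ∈ Ioc 0 ⌊x⌋₊, ArithmeticFunction.vonMangoldt n * (wZ (h :: t) (⌊x⌋₊ / n) : ℝ) =
        h.2 * Chebyshev.psi (x / h.1) +
        ∑ n ∈ Ioc 0 ⌊x⌋₊, ArithmeticFunction.vonMangoldt n * (wZ t (⌊x⌋₊ / n) : ℝ) := by
      rw [psi_div_eq x h.1 h1, Finset.mul_sum, ← Finset.sum_add_distrib]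
      apply Finset.sum_congr rfl
      intro n _
      rw [wZ_cons]; push_cast; ring
    have hd0 : (0 : ℝ) < h.1 := by exact_mod_cast h1
    have hXx : X ≤ x / h.1 := by
      rw [le_div_iff₀ hd0]
      have : (h.1 : ℝ) ≤ Y := by exact_mod_cast h2
      nlinarith
    obtain ⟨p1, p2⟩ := hab _ hXx
    have hm : (0 : ℝ) ≤ h.2 := Nat.cast_nonneg _
    have d1 : ((h.2 * 10000 / h.1 : ℕ) : ℝ) ≤ h.2 * 10000 / h.1 := by
      have := Nat.cast_div_le (α := ℝ) (m := h.2 * 10000) (n := h.1)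
      exact_mod_cast this
    have d2 : (h.2 * 10000 / h.1 : ℝ) ≤ ((h.2 * 10000 / h.1 : ℕ) : ℝ) + 1 := by
      rw [div_le_iff₀ hd0]
      have := Nat.lt_div_mul_add (a := h.2 * 10000) (b := h.1) h1
      have h' : h.2 * 10000 ≤ (h.2 * 10000 / h.1 + 1) * h.1 := by rw [add_mul, one_mul]; exact this.le
      exact_mod_cast h'
    rw [e, invUp, invDn]
    generalize h.2 * 10000 / h.1 = q at *
    push_cast
    have u1 := mul_le_mul_of_nonneg_left p2 hm
    have u2 := mul_le_mul_of_nonneg_left p1 hm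
    have e1 : (h.2 : ℝ) * (b * (x / h.1)) = x * b / 10000 * (h.2 * 10000 / h.1) := by field_simp
    have e2 : (h.2 : ℝ) * (a * (x / h.1)) = x * a / 10000 * (h.2 * 10000 / h.1) := by field_simp
    have v1 := mul_le_mul_of_nonneg_left d2 (by positivity : 0 ≤ x * b / 10000)
    have v2 := mul_le_mul_of_nonneg_left d1 (by positivity : 0 ≤ x * a / 10000)
    constructor <;> nlinarith

open Finset in
/-- The main certificate lemma. -/
lemma cert_step {Y : ℕ} (qL qR : ℕ) (mp mn zp zn : List (ℕ × ℕ))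
    (hchk : ∀ y, 1 ≤ y → y < Y → qL + (wS mn y + wZ zn y) ≤ qR + (wS mp y + wZ zp y))
    (htail : qL + (maxS mn + totZ zn) ≤ qR + totZ zp)
    (l1 : okLg mp = true) (l2 : okLg mn = true)
    (o1 : okL Y mp = true) (o2 : okL Y mn = true) (o3 : okL Y zp = true) (o4 : okL Y zn = true)
    (a b X x : ℝ)
    (hab : ∀ t, X ≤ t → a * t ≤ Chebyshev.psi t ∧ Chebyshev.psi t ≤ b * t)
    (ha : 0 ≤ a) (hb : 0 ≤ b) (hX : 1 ≤ X) (hx : Y * X ≤ x) (hx1 : 1 ≤ x) :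
    ((qL : ℝ) - qR) * Chebyshev.psi x ≤
      x * (((sumUp mp : ℝ) - sumDn mn) * (Real.log 2 / 65536) + b * (invUp zp / 10000)
        - a * (invDn zn / 10000)) + ((errS mp : ℝ) + errS mn) * (1 + Real.log (x + 1)) := by
  have hYx : (Y : ℝ) ≤ x := by
    have : (0 : ℝ) ≤ Y := Nat.cast_nonneg _
    nlinarith
  have hall : ∀ y, 1 ≤ y → qL + (wS mn y + wZ zn y) ≤ qR + (wS mp y + wZ zp y) := by
    intro y hy
    rcases lt_or_ge y Y with h | h
    · exact hchk y hy h
    · have h1 := wS_le_max mn o2 y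
      have h2 := wZ_le_tot zn y
      have h3 := wZ_eq_tot zp o3 y h
      omega
  have hpsi : Chebyshev.psi x = ∑ n ∈ Ioc 0 ⌊x⌋₊, ArithmeticFunction.vonMangoldt n := rfl
  have key : (qL : ℝ) * Chebyshev.psi x +
      (∑ n ∈ Ioc 0 ⌊x⌋₊, ArithmeticFunction.vonMangoldt n * (wS mn (⌊x⌋₊ / n) : ℝ) +
       ∑ n ∈ Ioc 0 ⌊x⌋₊, ArithmeticFunction.vonMangoldt n * (wZ zn (⌊x⌋₊ / n) : ℝ)) ≤
      (qR : ℝ) * Chebyshev.psi x +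
      (∑ n ∈ Ioc 0 ⌊x⌋₊, ArithmeticFunction.vonMangoldt n * (wS mp (⌊x⌋₊ / n) : ℝ) +
       ∑ n ∈ Ioc 0 ⌊x⌋₊, ArithmeticFunction.vonMangoldt n * (wZ zp (⌊x⌋₊ / n) : ℝ)) := by
    rw [hpsi, Finset.mul_sum, Finset.mul_sum, ← Finset.sum_add_distrib, ← Finset.sum_add_distrib,
      ← Finset.sum_add_distrib, ← Finset.sum_add_distrib]
    apply Finset.sum_le_sum
    intro n hn
    rw [Finset.mem_Ioc] at hn
    have h1 : 1 ≤ ⌊x⌋₊ / n := (Nat.le_div_iff_mul_le hn.1).2 (by omega)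
    have h2 : (qL : ℝ) + ((wS mn (⌊x⌋₊ / n) : ℝ) + (wZ zn (⌊x⌋₊ / n) : ℝ)) ≤
      qR + ((wS mp (⌊x⌋₊ / n) : ℝ) + (wZ zp (⌊x⌋₊ / n) : ℝ)) := by exact_mod_cast hall _ h1
    have h3 : 0 ≤ ArithmeticFunction.vonMangoldt n := ArithmeticFunction.vonMangoldt_nonneg
    have := mul_le_mul_of_nonneg_left h2 h3
    linarith
  have A1 := (sum_wS_le mp o1 l1 x hYx hx1).1
  have A2 := (sum_wS_le mn o2 l2 x hYx hx1).2
  have A3 := (sum_wZ_le zp o3 a b X x hab ha hb (by linarith) hx (by linarith)).1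
  have A4 := (sum_wZ_le zn o4 a b X x hab ha hb (by linarith) hx (by linarith)).2
  nlinarith


set_option maxRecDepth 100000

def upMp : List (ℕ × ℕ) :=
  [(2, 50000000), (3, 33333333), (5, 20000000), (7, 14285714), (11, 9090909), (13, 7692308),
   (17, 4495460), (19, 5263158), (23, 2784851), (29, 2456157), (30, 3333333), (31, 2451605),
   (37, 1355943), (41, 1326998), (42, 2380952), (43, 1489572), (47, 612158), (53, 1452479),
   (61, 390484), (66, 1515152), (67, 1059385), (70, 1428571), (71, 891276), (73, 322408),
   (78, 1028233), (79, 388863), (83, 483732), (89, 258636), (97, 676602), (101, 563115),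
   (102, 485447), (103, 279334), (105, 839585), (107, 264477), (109, 386955), (110, 610619),
   (113, 318128), (114, 877193), (127, 283058), (130, 676378), (137, 729927), (138, 464142),
   (139, 20899), (149, 338822), (154, 443084), (157, 202599), (163, 475157), (165, 270350),
   (167, 253059), (170, 158278), (174, 697692), (182, 128087), (190, 176003), (191, 335349),
   (195, 274008)]

def upMn : List (ℕ × ℕ) :=
  [(6, 16666667), (10, 10000000), (14, 7142857), (15, 6666667), (21, 4761905), (22, 4545455),
   (26, 3846154), (33, 3030303), (34, 2247730), (35, 2857143), (38, 2631579), (39, 2056466),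
   (46, 1392426), (51, 970894), (55, 1541046), (57, 1754386), (58, 1228079), (62, 879998),
   (65, 1352756), (69, 928284), (74, 154999), (77, 903255), (82, 663499), (85, 316556),
   (86, 744786), (87, 245959), (93, 133319), (95, 352006), (106, 614507), (111, 293517),
   (122, 82838), (123, 191348), (134, 529692), (142, 292730), (143, 138446), (146, 7092),
   (155, 58330), (159, 314606), (161, 98138), (178, 129318), (185, 34284)]

def upZp : List (ℕ × ℕ) :=
  [(1, 263), (39, 19797822), (51, 26907231), (55, 15242456), (65, 12070854), (77, 30449386),
   (87, 49830119), (91, 23018614), (93, 63601088), (94, 28771435), (95, 66559389),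
   (117, 19797822), (119, 76422827), (122, 13713339), (123, 30871135), (124, 21439848),
   (143, 33591547), (145, 71228565), (146, 22500356), (148, 38699971), (161, 37738718),
   (187, 76422827), (188, 28771435), (205, 54406907), (206, 28771435), (209, 100000000),
   (210, 88156391), (214, 3423263), (215, 64051582), (217, 75999748), (218, 42178095),
   (219, 23535772), (221, 58833379), (222, 6119538), (248, 11617415), (249, 40149747),
   (303, 80694118), (335, 82926946), (407, 54870374), (427, 52118605), (519, 4289791),
   (545, 87820772), (631, 24386728), (806, 78314446), (933, 43477530), (1080, 9420572),
   (1250, 194738281), (1379, 204460082), (1520, 115893028), (1759, 7247238), (1847, 99649307),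
   (2139, 105352640), (2476, 246617509), (3010, 105930292), (3160, 53168063), (3841, 78788816),
   (4669, 5037525), (4903, 109018459), (5148, 28615866), (5959, 104778223), (6257, 82310169),
   (7244, 8297380), (7606, 47278552), (8805, 50101086), (9245, 54527161), (9708, 160204261),
   (10000, 2312507297)]

def upZn : List (ℕ × ℕ) :=
  [(17, 23577173), (23, 35948418), (29, 28771435), (31, 24000252), (37, 49830119),
   (41, 45593093), (43, 35948418), (47, 71228565), (53, 23018614), (59, 100000000),
   (61, 54740633), (67, 29021219), (71, 36719433), (73, 37764258), (79, 69279786),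
   (83, 10334657), (97, 34369652), (101, 43125402), (103, 71228565), (107, 71700914),
   (109, 57821905), (149, 49515596), (151, 7449891), (163, 22549375), (167, 57739195),
   (179, 100000000), (191, 35948418), (193, 34369652), (195, 14699718), (197, 918056),
   (223, 64051582), (227, 100000000), (229, 100000000), (231, 69550614), (233, 40508351),
   (239, 100000000), (275, 64959722), (351, 80202178), (448, 135540714), (601, 56904165),
   (846, 7584208), (888, 75835306), (1191, 18207385), (1313, 125077009), (1447, 306216002),
   (1596, 45015425), (2037, 83362224), (2246, 107669263), (2358, 9843487), (2600, 83270682),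
   (2730, 121359678), (2866, 61760083), (3318, 33107351), (3484, 63446208), (3658, 8605010),
   (4033, 4672249), (4235, 73047175), (4447, 32770394), (5405, 74840465), (5676, 72843692),
   (6570, 103786724), (6899, 24499312), (7986, 59274808)]

def loMp : List (ℕ × ℕ) :=
  [(6, 16666667), (10, 10000000), (14, 7142857), (15, 6666667), (21, 4761905), (22, 4545455),
   (26, 3754806), (33, 3030303), (34, 2016500), (35, 2792854), (38, 2151459), (39, 2503204),
   (46, 1966006), (51, 1344333), (55, 91182), (57, 1072760), (58, 1123471), (62, 1050989),
   (65, 1234474), (69, 1449275), (74, 374552), (77, 865171), (82, 383402), (85, 56194),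
   (86, 1162791), (87, 400444), (91, 26099), (95, 113520), (106, 327383), (111, 417146),
   (118, 340116), (119, 280384), (123, 18293), (133, 88886), (134, 374435), (142, 661930),
   (143, 85306), (145, 240267), (146, 261578), (158, 300970), (159, 395738), (161, 59402),
   (166, 164704), (178, 159646), (183, 126843), (185, 245938), (187, 34193), (194, 153974)]

def loMn : List (ℕ × ℕ) :=
  [(2, 50000000), (3, 33333333), (5, 20000000), (7, 14285714), (11, 9090909), (13, 7692308),
   (17, 4033000), (19, 4302918), (23, 4347826), (29, 3448276), (30, 3333333), (31, 2101979),
   (37, 1413830), (41, 766805), (42, 2380952), (43, 2325581), (47, 489196), (53, 1841980),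
   (59, 794244), (61, 380529), (66, 1515152), (67, 1197624), (70, 1396427), (71, 1323861),
   (73, 1369863), (78, 1221153), (79, 843268), (83, 387653), (89, 472286), (97, 393715),
   (101, 130175), (102, 672167), (105, 875848), (109, 115530), (110, 45591), (113, 524387),
   (114, 536380), (127, 308914), (130, 280482), (131, 44167), (138, 790446), (139, 559318),
   (151, 291835), (154, 607941), (157, 49898), (165, 19731), (170, 28097), (173, 423167),
   (177, 126899), (179, 82748), (190, 207791), (195, 119931), (199, 159317)]

def loZp : List (ℕ × ℕ) :=
  [(1, 431), (17, 31438998), (19, 18244553), (31, 34838654), (37, 47688277), (41, 68561002),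
   (47, 67444050), (59, 18300949), (61, 76787754), (71, 6005889), (83, 67824782),
   (101, 86852291), (103, 100000000), (105, 3410861), (107, 37077671), (109, 87407192),
   (113, 34735812), (127, 31578982), (131, 35617233), (139, 3609539), (151, 55932925),
   (165, 1759327), (167, 95165637), (173, 6183919), (181, 100000000), (193, 86145053),
   (195, 46159912), (197, 100000000), (199, 68295931), (227, 40744320), (229, 100000000),
   (231, 57054457), (233, 65161346), (239, 37028658), (241, 100000000), (262, 25785534),
   (275, 20470985), (351, 97624957), (448, 167002053), (494, 67676195), (601, 100000000),
   (731, 69559977), (767, 79086453), (888, 21708363), (980, 47623800), (1080, 31489367),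
   (1191, 105273175), (1250, 105730841), (1447, 146611663), (1596, 114418449), (1759, 100000000),
   (1847, 11799085), (2476, 75655214), (2730, 1795963), (3318, 79474828), (3484, 73114355),
   (4033, 121728897), (4447, 39541251), (5148, 37183363), (5405, 45302532), (5959, 8702732),
   (6257, 30320392), (6570, 158752628), (8386, 34801809), (8805, 30664725), (10000, 2650266889)]

def loZn : List (ℕ × ℕ) :=
  [(26, 2375043), (35, 2250097), (39, 2375043), (55, 94985005), (57, 20608150), (74, 24594852),
   (85, 63784518), (87, 7194834), (91, 97624957), (92, 9563746), (93, 65161346), (94, 22992204),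
   (95, 9161339), (115, 100000000), (116, 34838654), (117, 2375043), (118, 6726663),
   (119, 35195274), (122, 23212246), (141, 22992204), (143, 87801231), (145, 51565882),
   (158, 19064970), (159, 25138882), (184, 9563746), (185, 6813204), (201, 80240804),
   (202, 13147709), (203, 100000000), (205, 31438998), (208, 2375043), (209, 73719447),
   (212, 62922329), (213, 93994111), (215, 100000000), (217, 65161346), (218, 12592808),
   (219, 46852638), (244, 23212246), (247, 13930665), (319, 100000000), (407, 95525880),
   (471, 111066952), (545, 87677693), (631, 83312307), (806, 47412575), (933, 60754543),
   (1029, 84663125), (1379, 197462557), (1520, 195466655), (1676, 71210693), (1940, 13715199),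
   (2139, 63178536), (2246, 9919246), (2358, 8737875), (3160, 28357126), (3658, 150813679),
   (3841, 19018080), (4235, 5860193), (4669, 77395573), (4903, 37484432), (5676, 88606618),
   (6899, 44745656), (7244, 47264676), (7986, 68735352), (9245, 36704181), (9708, 122301561)]

def upMpE (y : ℕ) : ℕ :=
  Nat.add (Nat.mul 50000000 (Nat.mod y 2)) (Nat.add (Nat.mul 33333333 (Nat.mod y 3)) (
  Nat.add (Nat.mul 20000000 (Nat.mod y 5)) (Nat.add (Nat.mul 14285714 (Nat.mod y 7)) (
  Nat.add (Nat.mul 9090909 (Nat.mod y 11)) (Nat.add (Nat.mul 7692308 (Nat.mod y 13)) (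
  Nat.add (Nat.mul 4495460 (Nat.mod y 17)) (Nat.add (Nat.mul 5263158 (Nat.mod y 19)) (
  Nat.add (Nat.mul 2784851 (Nat.mod y 23)) (Nat.add (Nat.mul 2456157 (Nat.mod y 29)) (
  Nat.add (Nat.mul 3333333 (Nat.mod y 30)) (Nat.add (Nat.mul 2451605 (Nat.mod y 31)) (
  Nat.add (Nat.mul 1355943 (Nat.mod y 37)) (Nat.add (Nat.mul 1326998 (Nat.mod y 41)) (
  Nat.add (Nat.mul 2380952 (Nat.mod y 42)) (Nat.add (Nat.mul 1489572 (Nat.mod y 43)) (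
  Nat.add (Nat.mul 612158 (Nat.mod y 47)) (Nat.add (Nat.mul 1452479 (Nat.mod y 53)) (
  Nat.add (Nat.mul 390484 (Nat.mod y 61)) (Nat.add (Nat.mul 1515152 (Nat.mod y 66)) (
  Nat.add (Nat.mul 1059385 (Nat.mod y 67)) (Nat.add (Nat.mul 1428571 (Nat.mod y 70)) (
  Nat.add (Nat.mul 891276 (Nat.mod y 71)) (Nat.add (Nat.mul 322408 (Nat.mod y 73)) (
  Nat.add (Nat.mul 1028233 (Nat.mod y 78)) (Nat.add (Nat.mul 388863 (Nat.mod y 79)) (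
  Nat.add (Nat.mul 483732 (Nat.mod y 83)) (Nat.add (Nat.mul 258636 (Nat.mod y 89)) (
  Nat.add (Nat.mul 676602 (Nat.mod y 97)) (Nat.add (Nat.mul 563115 (Nat.mod y 101)) (
  Nat.add (Nat.mul 485447 (Nat.mod y 102)) (Nat.add (Nat.mul 279334 (Nat.mod y 103)) (
  Nat.add (Nat.mul 839585 (Nat.mod y 105)) (Nat.add (Nat.mul 264477 (Nat.mod y 107)) (
  Nat.add (Nat.mul 386955 (Nat.mod y 109)) (Nat.add (Nat.mul 610619 (Nat.mod y 110)) (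
  Nat.add (Nat.mul 318128 (Nat.mod y 113)) (Nat.add (Nat.mul 877193 (Nat.mod y 114)) (
  Nat.add (Nat.mul 283058 (Nat.mod y 127)) (Nat.add (Nat.mul 676378 (Nat.mod y 130)) (
  Nat.add (Nat.mul 729927 (Nat.mod y 137)) (Nat.add (Nat.mul 464142 (Nat.mod y 138)) (
  Nat.add (Nat.mul 20899 (Nat.mod y 139)) (Nat.add (Nat.mul 338822 (Nat.mod y 149)) (
  Nat.add (Nat.mul 443084 (Nat.mod y 154)) (Nat.add (Nat.mul 202599 (Nat.mod y 157)) (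
  Nat.add (Nat.mul 475157 (Nat.mod y 163)) (Nat.add (Nat.mul 270350 (Nat.mod y 165)) (
  Nat.add (Nat.mul 253059 (Nat.mod y 167)) (Nat.add (Nat.mul 158278 (Nat.mod y 170)) (
  Nat.add (Nat.mul 697692 (Nat.mod y 174)) (Nat.add (Nat.mul 128087 (Nat.mod y 182)) (
  Nat.add (Nat.mul 176003 (Nat.mod y 190)) (Nat.add (Nat.mul 335349 (Nat.mod y 191)) (
  Nat.add (Nat.mul 274008 (Nat.mod y 195)) (0)))))))))))))))))))))))))))))))))))))))))))))))))))))))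

lemma upMpE_eq (y : ℕ) : wS upMp y = upMpE y := rfl

def upMnE (y : ℕ) : ℕ :=
  Nat.add (Nat.mul 16666667 (Nat.mod y 6)) (Nat.add (Nat.mul 10000000 (Nat.mod y 10)) (
  Nat.add (Nat.mul 7142857 (Nat.mod y 14)) (Nat.add (Nat.mul 6666667 (Nat.mod y 15)) (
  Nat.add (Nat.mul 4761905 (Nat.mod y 21)) (Nat.add (Nat.mul 4545455 (Nat.mod y 22)) (
  Nat.add (Nat.mul 3846154 (Nat.mod y 26)) (Nat.add (Nat.mul 3030303 (Nat.mod y 33)) (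
  Nat.add (Nat.mul 2247730 (Nat.mod y 34)) (Nat.add (Nat.mul 2857143 (Nat.mod y 35)) (
  Nat.add (Nat.mul 2631579 (Nat.mod y 38)) (Nat.add (Nat.mul 2056466 (Nat.mod y 39)) (
  Nat.add (Nat.mul 1392426 (Nat.mod y 46)) (Nat.add (Nat.mul 970894 (Nat.mod y 51)) (
  Nat.add (Nat.mul 1541046 (Nat.mod y 55)) (Nat.add (Nat.mul 1754386 (Nat.mod y 57)) (
  Nat.add (Nat.mul 1228079 (Nat.mod y 58)) (Nat.add (Nat.mul 879998 (Nat.mod y 62)) (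
  Nat.add (Nat.mul 1352756 (Nat.mod y 65)) (Nat.add (Nat.mul 928284 (Nat.mod y 69)) (
  Nat.add (Nat.mul 154999 (Nat.mod y 74)) (Nat.add (Nat.mul 903255 (Nat.mod y 77)) (
  Nat.add (Nat.mul 663499 (Nat.mod y 82)) (Nat.add (Nat.mul 316556 (Nat.mod y 85)) (
  Nat.add (Nat.mul 744786 (Nat.mod y 86)) (Nat.add (Nat.mul 245959 (Nat.mod y 87)) (
  Nat.add (Nat.mul 133319 (Nat.mod y 93)) (Nat.add (Nat.mul 352006 (Nat.mod y 95)) (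
  Nat.add (Nat.mul 614507 (Nat.mod y 106)) (Nat.add (Nat.mul 293517 (Nat.mod y 111)) (
  Nat.add (Nat.mul 82838 (Nat.mod y 122)) (Nat.add (Nat.mul 191348 (Nat.mod y 123)) (
  Nat.add (Nat.mul 529692 (Nat.mod y 134)) (Nat.add (Nat.mul 292730 (Nat.mod y 142)) (
  Nat.add (Nat.mul 138446 (Nat.mod y 143)) (Nat.add (Nat.mul 7092 (Nat.mod y 146)) (
  Nat.add (Nat.mul 58330 (Nat.mod y 155)) (Nat.add (Nat.mul 314606 (Nat.mod y 159)) (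
  Nat.add (Nat.mul 98138 (Nat.mod y 161)) (Nat.add (Nat.mul 129318 (Nat.mod y 178)) (
  Nat.add (Nat.mul 34284 (Nat.mod y 185)) (0)))))))))))))))))))))))))))))))))))))))))

lemma upMnE_eq (y : ℕ) : wS upMn y = upMnE y := rfl

def upZpE (y : ℕ) : ℕ :=
  Nat.add (Nat.mul 263 (Nat.sub 1 (Nat.sub 1 y))) (
  Nat.add (Nat.mul 19797822 (Nat.sub 1 (Nat.sub 39 y))) (
  Nat.add (Nat.mul 26907231 (Nat.sub 1 (Nat.sub 51 y))) (
  Nat.add (Nat.mul 15242456 (Nat.sub 1 (Nat.sub 55 y))) (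
  Nat.add (Nat.mul 12070854 (Nat.sub 1 (Nat.sub 65 y))) (
  Nat.add (Nat.mul 30449386 (Nat.sub 1 (Nat.sub 77 y))) (
  Nat.add (Nat.mul 49830119 (Nat.sub 1 (Nat.sub 87 y))) (
  Nat.add (Nat.mul 23018614 (Nat.sub 1 (Nat.sub 91 y))) (
  Nat.add (Nat.mul 63601088 (Nat.sub 1 (Nat.sub 93 y))) (
  Nat.add (Nat.mul 28771435 (Nat.sub 1 (Nat.sub 94 y))) (
  Nat.add (Nat.mul 66559389 (Nat.sub 1 (Nat.sub 95 y))) (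
  Nat.add (Nat.mul 19797822 (Nat.sub 1 (Nat.sub 117 y))) (
  Nat.add (Nat.mul 76422827 (Nat.sub 1 (Nat.sub 119 y))) (
  Nat.add (Nat.mul 13713339 (Nat.sub 1 (Nat.sub 122 y))) (
  Nat.add (Nat.mul 30871135 (Nat.sub 1 (Nat.sub 123 y))) (
  Nat.add (Nat.mul 21439848 (Nat.sub 1 (Nat.sub 124 y))) (
  Nat.add (Nat.mul 33591547 (Nat.sub 1 (Nat.sub 143 y))) (
  Nat.add (Nat.mul 71228565 (Nat.sub 1 (Nat.sub 145 y))) (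
  Nat.add (Nat.mul 22500356 (Nat.sub 1 (Nat.sub 146 y))) (
  Nat.add (Nat.mul 38699971 (Nat.sub 1 (Nat.sub 148 y))) (
  Nat.add (Nat.mul 37738718 (Nat.sub 1 (Nat.sub 161 y))) (
  Nat.add (Nat.mul 76422827 (Nat.sub 1 (Nat.sub 187 y))) (
  Nat.add (Nat.mul 28771435 (Nat.sub 1 (Nat.sub 188 y))) (
  Nat.add (Nat.mul 54406907 (Nat.sub 1 (Nat.sub 205 y))) (
  Nat.add (Nat.mul 28771435 (Nat.sub 1 (Nat.sub 206 y))) (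
  Nat.add (Nat.mul 100000000 (Nat.sub 1 (Nat.sub 209 y))) (
  Nat.add (Nat.mul 88156391 (Nat.sub 1 (Nat.sub 210 y))) (
  Nat.add (Nat.mul 3423263 (Nat.sub 1 (Nat.sub 214 y))) (
  Nat.add (Nat.mul 64051582 (Nat.sub 1 (Nat.sub 215 y))) (
  Nat.add (Nat.mul 75999748 (Nat.sub 1 (Nat.sub 217 y))) (
  Nat.add (Nat.mul 42178095 (Nat.sub 1 (Nat.sub 218 y))) (
  Nat.add (Nat.mul 23535772 (Nat.sub 1 (Nat.sub 219 y))) (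
  Nat.add (Nat.mul 58833379 (Nat.sub 1 (Nat.sub 221 y))) (
  Nat.add (Nat.mul 6119538 (Nat.sub 1 (Nat.sub 222 y))) (
  Nat.add (Nat.mul 11617415 (Nat.sub 1 (Nat.sub 248 y))) (
  Nat.add (Nat.mul 40149747 (Nat.sub 1 (Nat.sub 249 y))) (
  Nat.add (Nat.mul 80694118 (Nat.sub 1 (Nat.sub 303 y))) (
  Nat.add (Nat.mul 82926946 (Nat.sub 1 (Nat.sub 335 y))) (
  Nat.add (Nat.mul 54870374 (Nat.sub 1 (Nat.sub 407 y))) (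
  Nat.add (Nat.mul 52118605 (Nat.sub 1 (Nat.sub 427 y))) (
  Nat.add (Nat.mul 4289791 (Nat.sub 1 (Nat.sub 519 y))) (
  Nat.add (Nat.mul 87820772 (Nat.sub 1 (Nat.sub 545 y))) (
  Nat.add (Nat.mul 24386728 (Nat.sub 1 (Nat.sub 631 y))) (
  Nat.add (Nat.mul 78314446 (Nat.sub 1 (Nat.sub 806 y))) (
  Nat.add (Nat.mul 43477530 (Nat.sub 1 (Nat.sub 933 y))) (
  Nat.add (Nat.mul 9420572 (Nat.sub 1 (Nat.sub 1080 y))) (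
  Nat.add (Nat.mul 194738281 (Nat.sub 1 (Nat.sub 1250 y))) (
  Nat.add (Nat.mul 204460082 (Nat.sub 1 (Nat.sub 1379 y))) (
  Nat.add (Nat.mul 115893028 (Nat.sub 1 (Nat.sub 1520 y))) (
  Nat.add (Nat.mul 7247238 (Nat.sub 1 (Nat.sub 1759 y))) (
  Nat.add (Nat.mul 99649307 (Nat.sub 1 (Nat.sub 1847 y))) (
  Nat.add (Nat.mul 105352640 (Nat.sub 1 (Nat.sub 2139 y))) (
  Nat.add (Nat.mul 246617509 (Nat.sub 1 (Nat.sub 2476 y))) (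
  Nat.add (Nat.mul 105930292 (Nat.sub 1 (Nat.sub 3010 y))) (
  Nat.add (Nat.mul 53168063 (Nat.sub 1 (Nat.sub 3160 y))) (
  Nat.add (Nat.mul 78788816 (Nat.sub 1 (Nat.sub 3841 y))) (
  Nat.add (Nat.mul 5037525 (Nat.sub 1 (Nat.sub 4669 y))) (
  Nat.add (Nat.mul 109018459 (Nat.sub 1 (Nat.sub 4903 y))) (
  Nat.add (Nat.mul 28615866 (Nat.sub 1 (Nat.sub 5148 y))) (
  Nat.add (Nat.mul 104778223 (Nat.sub 1 (Nat.sub 5959 y))) (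
  Nat.add (Nat.mul 82310169 (Nat.sub 1 (Nat.sub 6257 y))) (
  Nat.add (Nat.mul 8297380 (Nat.sub 1 (Nat.sub 7244 y))) (
  Nat.add (Nat.mul 47278552 (Nat.sub 1 (Nat.sub 7606 y))) (
  Nat.add (Nat.mul 50101086 (Nat.sub 1 (Nat.sub 8805 y))) (
  Nat.add (Nat.mul 54527161 (Nat.sub 1 (Nat.sub 9245 y))) (
  Nat.add (Nat.mul 160204261 (Nat.sub 1 (Nat.sub 9708 y))) (
  Nat.add (Nat.mul 2312507297 (Nat.sub 1 (Nat.sub 10000 y))) (0)))))))))))))))))))))))))))))))))))))))))))))))))))))))))))))))))))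

lemma upZpE_eq (y : ℕ) : wZ upZp y = upZpE y := rfl

def upZnE (y : ℕ) : ℕ :=
  Nat.add (Nat.mul 23577173 (Nat.sub 1 (Nat.sub 17 y))) (
  Nat.add (Nat.mul 35948418 (Nat.sub 1 (Nat.sub 23 y))) (
  Nat.add (Nat.mul 28771435 (Nat.sub 1 (Nat.sub 29 y))) (
  Nat.add (Nat.mul 24000252 (Nat.sub 1 (Nat.sub 31 y))) (
  Nat.add (Nat.mul 49830119 (Nat.sub 1 (Nat.sub 37 y))) (
  Nat.add (Nat.mul 45593093 (Nat.sub 1 (Nat.sub 41 y))) (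
  Nat.add (Nat.mul 35948418 (Nat.sub 1 (Nat.sub 43 y))) (
  Nat.add (Nat.mul 71228565 (Nat.sub 1 (Nat.sub 47 y))) (
  Nat.add (Nat.mul 23018614 (Nat.sub 1 (Nat.sub 53 y))) (
  Nat.add (Nat.mul 100000000 (Nat.sub 1 (Nat.sub 59 y))) (
  Nat.add (Nat.mul 54740633 (Nat.sub 1 (Nat.sub 61 y))) (
  Nat.add (Nat.mul 29021219 (Nat.sub 1 (Nat.sub 67 y))) (
  Nat.add (Nat.mul 36719433 (Nat.sub 1 (Nat.sub 71 y))) (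
  Nat.add (Nat.mul 37764258 (Nat.sub 1 (Nat.sub 73 y))) (
  Nat.add (Nat.mul 69279786 (Nat.sub 1 (Nat.sub 79 y))) (
  Nat.add (Nat.mul 10334657 (Nat.sub 1 (Nat.sub 83 y))) (
  Nat.add (Nat.mul 34369652 (Nat.sub 1 (Nat.sub 97 y))) (
  Nat.add (Nat.mul 43125402 (Nat.sub 1 (Nat.sub 101 y))) (
  Nat.add (Nat.mul 71228565 (Nat.sub 1 (Nat.sub 103 y))) (
  Nat.add (Nat.mul 71700914 (Nat.sub 1 (Nat.sub 107 y))) (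
  Nat.add (Nat.mul 57821905 (Nat.sub 1 (Nat.sub 109 y))) (
  Nat.add (Nat.mul 49515596 (Nat.sub 1 (Nat.sub 149 y))) (
  Nat.add (Nat.mul 7449891 (Nat.sub 1 (Nat.sub 151 y))) (
  Nat.add (Nat.mul 22549375 (Nat.sub 1 (Nat.sub 163 y))) (
  Nat.add (Nat.mul 57739195 (Nat.sub 1 (Nat.sub 167 y))) (
  Nat.add (Nat.mul 100000000 (Nat.sub 1 (Nat.sub 179 y))) (
  Nat.add (Nat.mul 35948418 (Nat.sub 1 (Nat.sub 191 y))) (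
  Nat.add (Nat.mul 34369652 (Nat.sub 1 (Nat.sub 193 y))) (
  Nat.add (Nat.mul 14699718 (Nat.sub 1 (Nat.sub 195 y))) (
  Nat.add (Nat.mul 918056 (Nat.sub 1 (Nat.sub 197 y))) (
  Nat.add (Nat.mul 64051582 (Nat.sub 1 (Nat.sub 223 y))) (
  Nat.add (Nat.mul 100000000 (Nat.sub 1 (Nat.sub 227 y))) (
  Nat.add (Nat.mul 100000000 (Nat.sub 1 (Nat.sub 229 y))) (
  Nat.add (Nat.mul 69550614 (Nat.sub 1 (Nat.sub 231 y))) (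
  Nat.add (Nat.mul 40508351 (Nat.sub 1 (Nat.sub 233 y))) (
  Nat.add (Nat.mul 100000000 (Nat.sub 1 (Nat.sub 239 y))) (
  Nat.add (Nat.mul 64959722 (Nat.sub 1 (Nat.sub 275 y))) (
  Nat.add (Nat.mul 80202178 (Nat.sub 1 (Nat.sub 351 y))) (
  Nat.add (Nat.mul 135540714 (Nat.sub 1 (Nat.sub 448 y))) (
  Nat.add (Nat.mul 56904165 (Nat.sub 1 (Nat.sub 601 y))) (
  Nat.add (Nat.mul 7584208 (Nat.sub 1 (Nat.sub 846 y))) (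
  Nat.add (Nat.mul 75835306 (Nat.sub 1 (Nat.sub 888 y))) (
  Nat.add (Nat.mul 18207385 (Nat.sub 1 (Nat.sub 1191 y))) (
  Nat.add (Nat.mul 125077009 (Nat.sub 1 (Nat.sub 1313 y))) (
  Nat.add (Nat.mul 306216002 (Nat.sub 1 (Nat.sub 1447 y))) (
  Nat.add (Nat.mul 45015425 (Nat.sub 1 (Nat.sub 1596 y))) (
  Nat.add (Nat.mul 83362224 (Nat.sub 1 (Nat.sub 2037 y))) (
  Nat.add (Nat.mul 107669263 (Nat.sub 1 (Nat.sub 2246 y))) (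
  Nat.add (Nat.mul 9843487 (Nat.sub 1 (Nat.sub 2358 y))) (
  Nat.add (Nat.mul 83270682 (Nat.sub 1 (Nat.sub 2600 y))) (
  Nat.add (Nat.mul 121359678 (Nat.sub 1 (Nat.sub 2730 y))) (
  Nat.add (Nat.mul 61760083 (Nat.sub 1 (Nat.sub 2866 y))) (
  Nat.add (Nat.mul 33107351 (Nat.sub 1 (Nat.sub 3318 y))) (
  Nat.add (Nat.mul 63446208 (Nat.sub 1 (Nat.sub 3484 y))) (
  Nat.add (Nat.mul 8605010 (Nat.sub 1 (Nat.sub 3658 y))) (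
  Nat.add (Nat.mul 4672249 (Nat.sub 1 (Nat.sub 4033 y))) (
  Nat.add (Nat.mul 73047175 (Nat.sub 1 (Nat.sub 4235 y))) (
  Nat.add (Nat.mul 32770394 (Nat.sub 1 (Nat.sub 4447 y))) (
  Nat.add (Nat.mul 74840465 (Nat.sub 1 (Nat.sub 5405 y))) (
  Nat.add (Nat.mul 72843692 (Nat.sub 1 (Nat.sub 5676 y))) (
  Nat.add (Nat.mul 103786724 (Nat.sub 1 (Nat.sub 6570 y))) (
  Nat.add (Nat.mul 24499312 (Nat.sub 1 (Nat.sub 6899 y))) (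
  Nat.add (Nat.mul 59274808 (Nat.sub 1 (Nat.sub 7986 y))) (0)))))))))))))))))))))))))))))))))))))))))))))))))))))))))))))))

lemma upZnE_eq (y : ℕ) : wZ upZn y = upZnE y := rfl

noncomputable def upChk (n : ℕ) : Bool :=
  Nat.rec true (fun i ih => and (Nat.ble
    (Nat.add (Nat.mul 100000000 (Nat.sub 1 (Nat.sub 1 i))) (Nat.add (upMnE i) (upZnE i)))
    (Nat.add (upMpE i) (upZpE i))) ih) n

lemma upChk_succ (n : ℕ) : upChk (n + 1) = and (Nat.ble
    (Nat.add (Nat.mul 100000000 (Nat.sub 1 (Nat.sub 1 n))) (Nat.add (upMnE n) (upZnE n)))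
    (Nat.add (upMpE n) (upZpE n))) (upChk n) := rfl

lemma upChk_true : upChk 10000 = true := by decide +kernel

lemma upChk_all (n : ℕ) (h : upChk n = true) (y : ℕ) (hy : 1 ≤ y) (hyn : y < n) :
    100000000 + (wS upMn y + wZ upZn y) ≤ 0 + (wS upMp y + wZ upZp y) := by
  induction n with
  | zero => omega
  | succ n ih =>
    rw [upChk_succ, Bool.and_eq_true, Nat.ble_eq] at h
    rcases Nat.lt_succ_iff_lt_or_eq.1 hyn with h1 | h1
    · exact ih h.2 h1
    · subst h1
      have h2 := h.1
      simp only [← upMnE_eq, ← upZnE_eq, ← upMpE_eq, ← upZpE_eq, Nat.add_eq, Nat.mul_eq,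
        Nat.sub_eq] at h2
      have h3 : 1 - (1 - y) = 1 := by omega
      rw [h3] at h2
      omega

lemma up_sumUpMp : sumUp upMp = 33848010811092 := by decide +kernel

lemma up_sumDnMn : sumDn upMn = 23295381865981 := by decide +kernel

lemma up_invUpZp : invUp upZp = 125832781314 := by decide +kernel

lemma up_invDnZn : invDn upZn = 232316878928 := by decide +kernel

lemma up_errSMp : errS upMp = 3691353448 := by decide +kernel

lemma up_errSMn : errS upMn = 2478107598 := by decide +kernel

lemma up_okLgMp : okLg upMp = true := by decide +kernel

lemma up_okLgMn : okLg upMn = true := by decide +kernel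

lemma up_okMp : okL 10000 upMp = true := by decide +kernel

lemma up_okMn : okL 10000 upMn = true := by decide +kernel

lemma up_okZp : okL 10000 upZp = true := by decide +kernel

lemma up_okZn : okL 10000 upZn = true := by decide +kernel

lemma up_tail : 100000000 + (maxS upMn + totZ upZn) ≤ 0 + totZ upZp := by decide +kernel

def loMpE (y : ℕ) : ℕ :=
  Nat.add (Nat.mul 16666667 (Nat.mod y 6)) (Nat.add (Nat.mul 10000000 (Nat.mod y 10)) (
  Nat.add (Nat.mul 7142857 (Nat.mod y 14)) (Nat.add (Nat.mul 6666667 (Nat.mod y 15)) (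
  Nat.add (Nat.mul 4761905 (Nat.mod y 21)) (Nat.add (Nat.mul 4545455 (Nat.mod y 22)) (
  Nat.add (Nat.mul 3754806 (Nat.mod y 26)) (Nat.add (Nat.mul 3030303 (Nat.mod y 33)) (
  Nat.add (Nat.mul 2016500 (Nat.mod y 34)) (Nat.add (Nat.mul 2792854 (Nat.mod y 35)) (
  Nat.add (Nat.mul 2151459 (Nat.mod y 38)) (Nat.add (Nat.mul 2503204 (Nat.mod y 39)) (
  Nat.add (Nat.mul 1966006 (Nat.mod y 46)) (Nat.add (Nat.mul 1344333 (Nat.mod y 51)) (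
  Nat.add (Nat.mul 91182 (Nat.mod y 55)) (Nat.add (Nat.mul 1072760 (Nat.mod y 57)) (
  Nat.add (Nat.mul 1123471 (Nat.mod y 58)) (Nat.add (Nat.mul 1050989 (Nat.mod y 62)) (
  Nat.add (Nat.mul 1234474 (Nat.mod y 65)) (Nat.add (Nat.mul 1449275 (Nat.mod y 69)) (
  Nat.add (Nat.mul 374552 (Nat.mod y 74)) (Nat.add (Nat.mul 865171 (Nat.mod y 77)) (
  Nat.add (Nat.mul 383402 (Nat.mod y 82)) (Nat.add (Nat.mul 56194 (Nat.mod y 85)) (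
  Nat.add (Nat.mul 1162791 (Nat.mod y 86)) (Nat.add (Nat.mul 400444 (Nat.mod y 87)) (
  Nat.add (Nat.mul 26099 (Nat.mod y 91)) (Nat.add (Nat.mul 113520 (Nat.mod y 95)) (
  Nat.add (Nat.mul 327383 (Nat.mod y 106)) (Nat.add (Nat.mul 417146 (Nat.mod y 111)) (
  Nat.add (Nat.mul 340116 (Nat.mod y 118)) (Nat.add (Nat.mul 280384 (Nat.mod y 119)) (
  Nat.add (Nat.mul 18293 (Nat.mod y 123)) (Nat.add (Nat.mul 88886 (Nat.mod y 133)) (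
  Nat.add (Nat.mul 374435 (Nat.mod y 134)) (Nat.add (Nat.mul 661930 (Nat.mod y 142)) (
  Nat.add (Nat.mul 85306 (Nat.mod y 143)) (Nat.add (Nat.mul 240267 (Nat.mod y 145)) (
  Nat.add (Nat.mul 261578 (Nat.mod y 146)) (Nat.add (Nat.mul 300970 (Nat.mod y 158)) (
  Nat.add (Nat.mul 395738 (Nat.mod y 159)) (Nat.add (Nat.mul 59402 (Nat.mod y 161)) (
  Nat.add (Nat.mul 164704 (Nat.mod y 166)) (Nat.add (Nat.mul 159646 (Nat.mod y 178)) (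
  Nat.add (Nat.mul 126843 (Nat.mod y 183)) (Nat.add (Nat.mul 245938 (Nat.mod y 185)) (
  Nat.add (Nat.mul 34193 (Nat.mod y 187)) (Nat.add (Nat.mul 153974 (Nat.mod y 194)) (0))))))))))))))))))))))))))))))))))))))))))))))))

lemma loMpE_eq (y : ℕ) : wS loMp y = loMpE y := rfl

def loMnE (y : ℕ) : ℕ :=
  Nat.add (Nat.mul 50000000 (Nat.mod y 2)) (Nat.add (Nat.mul 33333333 (Nat.mod y 3)) (
  Nat.add (Nat.mul 20000000 (Nat.mod y 5)) (Nat.add (Nat.mul 14285714 (Nat.mod y 7)) (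
  Nat.add (Nat.mul 9090909 (Nat.mod y 11)) (Nat.add (Nat.mul 7692308 (Nat.mod y 13)) (
  Nat.add (Nat.mul 4033000 (Nat.mod y 17)) (Nat.add (Nat.mul 4302918 (Nat.mod y 19)) (
  Nat.add (Nat.mul 4347826 (Nat.mod y 23)) (Nat.add (Nat.mul 3448276 (Nat.mod y 29)) (
  Nat.add (Nat.mul 3333333 (Nat.mod y 30)) (Nat.add (Nat.mul 2101979 (Nat.mod y 31)) (
  Nat.add (Nat.mul 1413830 (Nat.mod y 37)) (Nat.add (Nat.mul 766805 (Nat.mod y 41)) (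
  Nat.add (Nat.mul 2380952 (Nat.mod y 42)) (Nat.add (Nat.mul 2325581 (Nat.mod y 43)) (
  Nat.add (Nat.mul 489196 (Nat.mod y 47)) (Nat.add (Nat.mul 1841980 (Nat.mod y 53)) (
  Nat.add (Nat.mul 794244 (Nat.mod y 59)) (Nat.add (Nat.mul 380529 (Nat.mod y 61)) (
  Nat.add (Nat.mul 1515152 (Nat.mod y 66)) (Nat.add (Nat.mul 1197624 (Nat.mod y 67)) (
  Nat.add (Nat.mul 1396427 (Nat.mod y 70)) (Nat.add (Nat.mul 1323861 (Nat.mod y 71)) (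
  Nat.add (Nat.mul 1369863 (Nat.mod y 73)) (Nat.add (Nat.mul 1221153 (Nat.mod y 78)) (
  Nat.add (Nat.mul 843268 (Nat.mod y 79)) (Nat.add (Nat.mul 387653 (Nat.mod y 83)) (
  Nat.add (Nat.mul 472286 (Nat.mod y 89)) (Nat.add (Nat.mul 393715 (Nat.mod y 97)) (
  Nat.add (Nat.mul 130175 (Nat.mod y 101)) (Nat.add (Nat.mul 672167 (Nat.mod y 102)) (
  Nat.add (Nat.mul 875848 (Nat.mod y 105)) (Nat.add (Nat.mul 115530 (Nat.mod y 109)) (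
  Nat.add (Nat.mul 45591 (Nat.mod y 110)) (Nat.add (Nat.mul 524387 (Nat.mod y 113)) (
  Nat.add (Nat.mul 536380 (Nat.mod y 114)) (Nat.add (Nat.mul 308914 (Nat.mod y 127)) (
  Nat.add (Nat.mul 280482 (Nat.mod y 130)) (Nat.add (Nat.mul 44167 (Nat.mod y 131)) (
  Nat.add (Nat.mul 790446 (Nat.mod y 138)) (Nat.add (Nat.mul 559318 (Nat.mod y 139)) (
  Nat.add (Nat.mul 291835 (Nat.mod y 151)) (Nat.add (Nat.mul 607941 (Nat.mod y 154)) (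
  Nat.add (Nat.mul 49898 (Nat.mod y 157)) (Nat.add (Nat.mul 19731 (Nat.mod y 165)) (
  Nat.add (Nat.mul 28097 (Nat.mod y 170)) (Nat.add (Nat.mul 423167 (Nat.mod y 173)) (
  Nat.add (Nat.mul 126899 (Nat.mod y 177)) (Nat.add (Nat.mul 82748 (Nat.mod y 179)) (
  Nat.add (Nat.mul 207791 (Nat.mod y 190)) (Nat.add (Nat.mul 119931 (Nat.mod y 195)) (
  Nat.add (Nat.mul 159317 (Nat.mod y 199)) (0)))))))))))))))))))))))))))))))))))))))))))))))))))))

lemma loMnE_eq (y : ℕ) : wS loMn y = loMnE y := rfl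

def loZpE (y : ℕ) : ℕ :=
  Nat.add (Nat.mul 431 (Nat.sub 1 (Nat.sub 1 y))) (
  Nat.add (Nat.mul 31438998 (Nat.sub 1 (Nat.sub 17 y))) (
  Nat.add (Nat.mul 18244553 (Nat.sub 1 (Nat.sub 19 y))) (
  Nat.add (Nat.mul 34838654 (Nat.sub 1 (Nat.sub 31 y))) (
  Nat.add (Nat.mul 47688277 (Nat.sub 1 (Nat.sub 37 y))) (
  Nat.add (Nat.mul 68561002 (Nat.sub 1 (Nat.sub 41 y))) (
  Nat.add (Nat.mul 67444050 (Nat.sub 1 (Nat.sub 47 y))) (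
  Nat.add (Nat.mul 18300949 (Nat.sub 1 (Nat.sub 59 y))) (
  Nat.add (Nat.mul 76787754 (Nat.sub 1 (Nat.sub 61 y))) (
  Nat.add (Nat.mul 6005889 (Nat.sub 1 (Nat.sub 71 y))) (
  Nat.add (Nat.mul 67824782 (Nat.sub 1 (Nat.sub 83 y))) (
  Nat.add (Nat.mul 86852291 (Nat.sub 1 (Nat.sub 101 y))) (
  Nat.add (Nat.mul 100000000 (Nat.sub 1 (Nat.sub 103 y))) (
  Nat.add (Nat.mul 3410861 (Nat.sub 1 (Nat.sub 105 y))) (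
  Nat.add (Nat.mul 37077671 (Nat.sub 1 (Nat.sub 107 y))) (
  Nat.add (Nat.mul 87407192 (Nat.sub 1 (Nat.sub 109 y))) (
  Nat.add (Nat.mul 34735812 (Nat.sub 1 (Nat.sub 113 y))) (
  Nat.add (Nat.mul 31578982 (Nat.sub 1 (Nat.sub 127 y))) (
  Nat.add (Nat.mul 35617233 (Nat.sub 1 (Nat.sub 131 y))) (
  Nat.add (Nat.mul 3609539 (Nat.sub 1 (Nat.sub 139 y))) (
  Nat.add (Nat.mul 55932925 (Nat.sub 1 (Nat.sub 151 y))) (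
  Nat.add (Nat.mul 1759327 (Nat.sub 1 (Nat.sub 165 y))) (
  Nat.add (Nat.mul 95165637 (Nat.sub 1 (Nat.sub 167 y))) (
  Nat.add (Nat.mul 6183919 (Nat.sub 1 (Nat.sub 173 y))) (
  Nat.add (Nat.mul 100000000 (Nat.sub 1 (Nat.sub 181 y))) (
  Nat.add (Nat.mul 86145053 (Nat.sub 1 (Nat.sub 193 y))) (
  Nat.add (Nat.mul 46159912 (Nat.sub 1 (Nat.sub 195 y))) (
  Nat.add (Nat.mul 100000000 (Nat.sub 1 (Nat.sub 197 y))) (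
  Nat.add (Nat.mul 68295931 (Nat.sub 1 (Nat.sub 199 y))) (
  Nat.add (Nat.mul 40744320 (Nat.sub 1 (Nat.sub 227 y))) (
  Nat.add (Nat.mul 100000000 (Nat.sub 1 (Nat.sub 229 y))) (
  Nat.add (Nat.mul 57054457 (Nat.sub 1 (Nat.sub 231 y))) (
  Nat.add (Nat.mul 65161346 (Nat.sub 1 (Nat.sub 233 y))) (
  Nat.add (Nat.mul 37028658 (Nat.sub 1 (Nat.sub 239 y))) (
  Nat.add (Nat.mul 100000000 (Nat.sub 1 (Nat.sub 241 y))) (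
  Nat.add (Nat.mul 25785534 (Nat.sub 1 (Nat.sub 262 y))) (
  Nat.add (Nat.mul 20470985 (Nat.sub 1 (Nat.sub 275 y))) (
  Nat.add (Nat.mul 97624957 (Nat.sub 1 (Nat.sub 351 y))) (
  Nat.add (Nat.mul 167002053 (Nat.sub 1 (Nat.sub 448 y))) (
  Nat.add (Nat.mul 67676195 (Nat.sub 1 (Nat.sub 494 y))) (
  Nat.add (Nat.mul 100000000 (Nat.sub 1 (Nat.sub 601 y))) (
  Nat.add (Nat.mul 69559977 (Nat.sub 1 (Nat.sub 731 y))) (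
  Nat.add (Nat.mul 79086453 (Nat.sub 1 (Nat.sub 767 y))) (
  Nat.add (Nat.mul 21708363 (Nat.sub 1 (Nat.sub 888 y))) (
  Nat.add (Nat.mul 47623800 (Nat.sub 1 (Nat.sub 980 y))) (
  Nat.add (Nat.mul 31489367 (Nat.sub 1 (Nat.sub 1080 y))) (
  Nat.add (Nat.mul 105273175 (Nat.sub 1 (Nat.sub 1191 y))) (
  Nat.add (Nat.mul 105730841 (Nat.sub 1 (Nat.sub 1250 y))) (
  Nat.add (Nat.mul 146611663 (Nat.sub 1 (Nat.sub 1447 y))) (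
  Nat.add (Nat.mul 114418449 (Nat.sub 1 (Nat.sub 1596 y))) (
  Nat.add (Nat.mul 100000000 (Nat.sub 1 (Nat.sub 1759 y))) (
  Nat.add (Nat.mul 11799085 (Nat.sub 1 (Nat.sub 1847 y))) (
  Nat.add (Nat.mul 75655214 (Nat.sub 1 (Nat.sub 2476 y))) (
  Nat.add (Nat.mul 1795963 (Nat.sub 1 (Nat.sub 2730 y))) (
  Nat.add (Nat.mul 79474828 (Nat.sub 1 (Nat.sub 3318 y))) (
  Nat.add (Nat.mul 73114355 (Nat.sub 1 (Nat.sub 3484 y))) (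
  Nat.add (Nat.mul 121728897 (Nat.sub 1 (Nat.sub 4033 y))) (
  Nat.add (Nat.mul 39541251 (Nat.sub 1 (Nat.sub 4447 y))) (
  Nat.add (Nat.mul 37183363 (Nat.sub 1 (Nat.sub 5148 y))) (
  Nat.add (Nat.mul 45302532 (Nat.sub 1 (Nat.sub 5405 y))) (
  Nat.add (Nat.mul 8702732 (Nat.sub 1 (Nat.sub 5959 y))) (
  Nat.add (Nat.mul 30320392 (Nat.sub 1 (Nat.sub 6257 y))) (
  Nat.add (Nat.mul 158752628 (Nat.sub 1 (Nat.sub 6570 y))) (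
  Nat.add (Nat.mul 34801809 (Nat.sub 1 (Nat.sub 8386 y))) (
  Nat.add (Nat.mul 30664725 (Nat.sub 1 (Nat.sub 8805 y))) (
  Nat.add (Nat.mul 2650266889 (Nat.sub 1 (Nat.sub 10000 y))) (0))))))))))))))))))))))))))))))))))))))))))))))))))))))))))))))))))

lemma loZpE_eq (y : ℕ) : wZ loZp y = loZpE y := rfl

def loZnE (y : ℕ) : ℕ :=
  Nat.add (Nat.mul 2375043 (Nat.sub 1 (Nat.sub 26 y))) (
  Nat.add (Nat.mul 2250097 (Nat.sub 1 (Nat.sub 35 y))) (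
  Nat.add (Nat.mul 2375043 (Nat.sub 1 (Nat.sub 39 y))) (
  Nat.add (Nat.mul 94985005 (Nat.sub 1 (Nat.sub 55 y))) (
  Nat.add (Nat.mul 20608150 (Nat.sub 1 (Nat.sub 57 y))) (
  Nat.add (Nat.mul 24594852 (Nat.sub 1 (Nat.sub 74 y))) (
  Nat.add (Nat.mul 63784518 (Nat.sub 1 (Nat.sub 85 y))) (
  Nat.add (Nat.mul 7194834 (Nat.sub 1 (Nat.sub 87 y))) (
  Nat.add (Nat.mul 97624957 (Nat.sub 1 (Nat.sub 91 y))) (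
  Nat.add (Nat.mul 9563746 (Nat.sub 1 (Nat.sub 92 y))) (
  Nat.add (Nat.mul 65161346 (Nat.sub 1 (Nat.sub 93 y))) (
  Nat.add (Nat.mul 22992204 (Nat.sub 1 (Nat.sub 94 y))) (
  Nat.add (Nat.mul 9161339 (Nat.sub 1 (Nat.sub 95 y))) (
  Nat.add (Nat.mul 100000000 (Nat.sub 1 (Nat.sub 115 y))) (
  Nat.add (Nat.mul 34838654 (Nat.sub 1 (Nat.sub 116 y))) (
  Nat.add (Nat.mul 2375043 (Nat.sub 1 (Nat.sub 117 y))) (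
  Nat.add (Nat.mul 6726663 (Nat.sub 1 (Nat.sub 118 y))) (
  Nat.add (Nat.mul 35195274 (Nat.sub 1 (Nat.sub 119 y))) (
  Nat.add (Nat.mul 23212246 (Nat.sub 1 (Nat.sub 122 y))) (
  Nat.add (Nat.mul 22992204 (Nat.sub 1 (Nat.sub 141 y))) (
  Nat.add (Nat.mul 87801231 (Nat.sub 1 (Nat.sub 143 y))) (
  Nat.add (Nat.mul 51565882 (Nat.sub 1 (Nat.sub 145 y))) (
  Nat.add (Nat.mul 19064970 (Nat.sub 1 (Nat.sub 158 y))) (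
  Nat.add (Nat.mul 25138882 (Nat.sub 1 (Nat.sub 159 y))) (
  Nat.add (Nat.mul 9563746 (Nat.sub 1 (Nat.sub 184 y))) (
  Nat.add (Nat.mul 6813204 (Nat.sub 1 (Nat.sub 185 y))) (
  Nat.add (Nat.mul 80240804 (Nat.sub 1 (Nat.sub 201 y))) (
  Nat.add (Nat.mul 13147709 (Nat.sub 1 (Nat.sub 202 y))) (
  Nat.add (Nat.mul 100000000 (Nat.sub 1 (Nat.sub 203 y))) (
  Nat.add (Nat.mul 31438998 (Nat.sub 1 (Nat.sub 205 y))) (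
  Nat.add (Nat.mul 2375043 (Nat.sub 1 (Nat.sub 208 y))) (
  Nat.add (Nat.mul 73719447 (Nat.sub 1 (Nat.sub 209 y))) (
  Nat.add (Nat.mul 62922329 (Nat.sub 1 (Nat.sub 212 y))) (
  Nat.add (Nat.mul 93994111 (Nat.sub 1 (Nat.sub 213 y))) (
  Nat.add (Nat.mul 100000000 (Nat.sub 1 (Nat.sub 215 y))) (
  Nat.add (Nat.mul 65161346 (Nat.sub 1 (Nat.sub 217 y))) (
  Nat.add (Nat.mul 12592808 (Nat.sub 1 (Nat.sub 218 y))) (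
  Nat.add (Nat.mul 46852638 (Nat.sub 1 (Nat.sub 219 y))) (
  Nat.add (Nat.mul 23212246 (Nat.sub 1 (Nat.sub 244 y))) (
  Nat.add (Nat.mul 13930665 (Nat.sub 1 (Nat.sub 247 y))) (
  Nat.add (Nat.mul 100000000 (Nat.sub 1 (Nat.sub 319 y))) (
  Nat.add (Nat.mul 95525880 (Nat.sub 1 (Nat.sub 407 y))) (
  Nat.add (Nat.mul 111066952 (Nat.sub 1 (Nat.sub 471 y))) (
  Nat.add (Nat.mul 87677693 (Nat.sub 1 (Nat.sub 545 y))) (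
  Nat.add (Nat.mul 83312307 (Nat.sub 1 (Nat.sub 631 y))) (
  Nat.add (Nat.mul 47412575 (Nat.sub 1 (Nat.sub 806 y))) (
  Nat.add (Nat.mul 60754543 (Nat.sub 1 (Nat.sub 933 y))) (
  Nat.add (Nat.mul 84663125 (Nat.sub 1 (Nat.sub 1029 y))) (
  Nat.add (Nat.mul 197462557 (Nat.sub 1 (Nat.sub 1379 y))) (
  Nat.add (Nat.mul 195466655 (Nat.sub 1 (Nat.sub 1520 y))) (
  Nat.add (Nat.mul 71210693 (Nat.sub 1 (Nat.sub 1676 y))) (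
  Nat.add (Nat.mul 13715199 (Nat.sub 1 (Nat.sub 1940 y))) (
  Nat.add (Nat.mul 63178536 (Nat.sub 1 (Nat.sub 2139 y))) (
  Nat.add (Nat.mul 9919246 (Nat.sub 1 (Nat.sub 2246 y))) (
  Nat.add (Nat.mul 8737875 (Nat.sub 1 (Nat.sub 2358 y))) (
  Nat.add (Nat.mul 28357126 (Nat.sub 1 (Nat.sub 3160 y))) (
  Nat.add (Nat.mul 150813679 (Nat.sub 1 (Nat.sub 3658 y))) (
  Nat.add (Nat.mul 19018080 (Nat.sub 1 (Nat.sub 3841 y))) (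
  Nat.add (Nat.mul 5860193 (Nat.sub 1 (Nat.sub 4235 y))) (
  Nat.add (Nat.mul 77395573 (Nat.sub 1 (Nat.sub 4669 y))) (
  Nat.add (Nat.mul 37484432 (Nat.sub 1 (Nat.sub 4903 y))) (
  Nat.add (Nat.mul 88606618 (Nat.sub 1 (Nat.sub 5676 y))) (
  Nat.add (Nat.mul 44745656 (Nat.sub 1 (Nat.sub 6899 y))) (
  Nat.add (Nat.mul 47264676 (Nat.sub 1 (Nat.sub 7244 y))) (
  Nat.add (Nat.mul 68735352 (Nat.sub 1 (Nat.sub 7986 y))) (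
  Nat.add (Nat.mul 36704181 (Nat.sub 1 (Nat.sub 9245 y))) (
  Nat.add (Nat.mul 122301561 (Nat.sub 1 (Nat.sub 9708 y))) (0)))))))))))))))))))))))))))))))))))))))))))))))))))))))))))))))))))

lemma loZnE_eq (y : ℕ) : wZ loZn y = loZnE y := rfl

noncomputable def loChk (n : ℕ) : Bool :=
  Nat.rec true (fun i ih => and (Nat.ble
    (Nat.add (loMnE i) (loZnE i))
    (Nat.add 100000000 (Nat.add (loMpE i) (loZpE i)))) ih) n

lemma loChk_succ (n : ℕ) : loChk (n + 1) = and (Nat.ble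
    (Nat.add (loMnE n) (loZnE n))
    (Nat.add 100000000 (Nat.add (loMpE n) (loZpE n)))) (loChk n) := rfl

lemma loChk_true : loChk 10000 = true := by decide +kernel

lemma loChk_all (n : ℕ) (h : loChk n = true) (y : ℕ) (hy : 1 ≤ y) (hyn : y < n) :
    0 + (wS loMn y + wZ loZn y) ≤ 100000000 + (wS loMp y + wZ loZp y) := by
  induction n with
  | zero => omega
  | succ n ih =>
    rw [loChk_succ, Bool.and_eq_true, Nat.ble_eq] at h
    rcases Nat.lt_succ_iff_lt_or_eq.1 hyn with h1 | h1
    · exact ih h.2 h1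
    · subst h1
      have h2 := h.1
      simp only [← loMnE_eq, ← loZnE_eq, ← loMpE_eq, ← loZpE_eq, Nat.add_eq, Nat.mul_eq,
        Nat.sub_eq] at h2
      omega

lemma lo_sumUpMp : sumUp loMp = 23757423053598 := by decide +kernel

lemma lo_sumDnMn : sumDn loMn = 33840150799090 := by decide +kernel

lemma lo_invUpZp : invUp loZp = 217228233365 := by decide +kernel

lemma lo_invDnZn : invDn loZn = 141003088952 := by decide +kernel

lemma lo_errSMp : errS loMp = 2719818575 := by decide +kernel

lemma lo_errSMn : errS loMn = 3458253590 := by decide +kernel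

lemma lo_okLgMp : okLg loMp = true := by decide +kernel

lemma lo_okLgMn : okLg loMn = true := by decide +kernel

lemma lo_okMp : okL 10000 loMp = true := by decide +kernel

lemma lo_okMn : okL 10000 loMn = true := by decide +kernel

lemma lo_okZp : okL 10000 loZp = true := by decide +kernel

lemma lo_okZn : okL 10000 loZn = true := by decide +kernel

lemma lo_tail : 0 + (maxS loMn + totZ loZn) ≤ 100000000 + totZ loZp := by decide +kernel


lemma log_err (x : ℝ) (hx : 10 ^ 8 ≤ x) : 1 + Real.log (x + 1) ≤ 2.4 / 10 ^ 7 * x := by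
  have h := Real.log_le_sub_one_of_pos (x := (x + 1) / 10 ^ 8) (by positivity)
  rw [Real.log_div (by positivity) (by positivity)] at h
  have h2 : Real.log (10 ^ 8 : ℝ) ≤ 27 * Real.log 2 := by
    rw [← Real.log_rpow (by norm_num)]
    apply Real.log_le_log (by norm_num)
    norm_num
  have h3 := Real.log_two_lt_d9
  norm_num at *
  linarith

/-- Chebyshev-type bounds `a t ≤ ψ(t) ≤ b t` for `t ≥ X`. -/
def PsiBd (a b X : ℝ) : Prop :=
  ∀ t, X ≤ t → a * t ≤ Chebyshev.psi t ∧ Chebyshev.psi t ≤ b * t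

lemma psi_step {a b X : ℝ} (a' b' : ℝ) (H : PsiBd a b X) (ha : 0 ≤ a) (hb : 0 ≤ b)
    (hX : 10 ^ 4 ≤ X)
    (hb' : 1.116109 + 0.125833 * b - 0.232316 * a + 0.00002 ≤ b')
    (ha' : a' ≤ 1.066407 + 0.141003 * a - 0.217229 * b - 0.00002 ∨ a' = 0) :
    PsiBd a' b' (10 ^ 4 * X) := by
  intro x hx
  have hx8 : 10 ^ 8 ≤ x := by linarith
  have hx1 : 1 ≤ x := by linarith
  have hx0 : 0 < x := by linarith
  have he := log_err x hx8
  have l1 := Real.log_two_gt_d9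
  have l2 := Real.log_two_lt_d9
  have hcast : ((10000 : ℕ) : ℝ) * X ≤ x := by push_cast; linarith
  have hbx : 0 ≤ b * x := by positivity
  have hax : 0 ≤ a * x := by positivity
  constructor
  · rcases ha' with ha' | ha'
    · have h := cert_step (Y := 10000) 0 100000000 loMp loMn loZp loZn
        (loChk_all 10000 loChk_true) lo_tail lo_okLgMp lo_okLgMn lo_okMp lo_okMn lo_okZp lo_okZn
        a b X x H ha hb (by linarith) hcast hx1
      rw [lo_sumUpMp, lo_sumDnMn, lo_invUpZp, lo_invDnZn, lo_errSMp, lo_errSMn] at h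
      push_cast at h
      have hA := mul_le_mul_of_nonneg_right ha' hx0.le
      have hL := mul_le_mul_of_nonneg_left l1.le hx0.le
      nlinarith
    · rw [ha', zero_mul]; exact Chebyshev.psi_nonneg x
  · have h := cert_step (Y := 10000) 100000000 0 upMp upMn upZp upZn
      (upChk_all 10000 upChk_true) up_tail up_okLgMp up_okLgMn up_okMp up_okMn up_okZp up_okZn
      a b X x H ha hb (by linarith) hcast hx1
    rw [up_sumUpMp, up_sumDnMn, up_invUpZp, up_invDnZn, up_errSMp, up_errSMn] at h
    push_cast at h
    have hB := mul_le_mul_of_nonneg_right hb' hx0.le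
    have hL := mul_le_mul_of_nonneg_left l2.le hx0.le
    nlinarith

lemma psi_final : PsiBd 0.98402 1.0158 (10 ^ 36) := by
  have h0 : PsiBd 0 6 (10 ^ 4) := by
    intro t ht
    refine ⟨by rw [zero_mul]; exact Chebyshev.psi_nonneg t, ?_⟩
    have ht0 : (0 : ℝ) ≤ t := by linarith
    refine (Chebyshev.psi_le_const_mul_self ht0).trans ?_
    have : Real.log 4 ≤ 2 := by
      rw [show (4 : ℝ) = 2 ^ 2 by norm_num, Real.log_pow]
      have := Real.log_two_lt_d9
      push_cast; linarith
    nlinarith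
  have h1 := psi_step 0 1.87113 h0 (by norm_num) (by norm_num) (by norm_num) (by norm_num)
    (Or.inr rfl)
  have h2 := psi_step 0.65992 1.35158 h1 (by norm_num) (by norm_num) (by norm_num) (by norm_num)
    (Or.inl (by norm_num))
  have h3 := psi_step 0.86583 1.1329 h2 (by norm_num) (by norm_num) (by norm_num) (by norm_num)
    (Or.inl (by norm_num))
  have h4 := psi_step 0.94237 1.05754 h3 (by norm_num) (by norm_num) (by norm_num) (by norm_num)
    (Or.inl (by norm_num))
  have h5 := psi_step 0.96953 1.03028 h4 (by norm_num) (by norm_num) (by norm_num) (by norm_num)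
    (Or.inl (by norm_num))
  have h6 := psi_step 0.97928 1.02054 h5 (by norm_num) (by norm_num) (by norm_num) (by norm_num)
    (Or.inl (by norm_num))
  have h7 := psi_step 0.98277 1.01705 h6 (by norm_num) (by norm_num) (by norm_num) (by norm_num)
    (Or.inl (by norm_num))
  have h8 := psi_step 0.98402 1.0158 h7 (by norm_num) (by norm_num) (by norm_num) (by norm_num)
    (Or.inl (by norm_num))
  intro t ht
  exact h8 t (by linarith)

lemma sqrt_log_err (x : ℝ) (hx : 10 ^ 36 ≤ x) : 2 * √x * Real.log x ≤ 0.001 * x := by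
  have hx0 : 0 < x := by linarith
  have hs : 10 ^ 18 ≤ √x := by
    apply Real.le_sqrt_of_sq_le
    linarith
  have hsq : √x * √x = x := Real.mul_self_sqrt hx0.le
  have hlog : Real.log x = 2 * Real.log √x := by
    rw [Real.log_sqrt hx0.le]; ring
  set s := √x with hsdef
  have hs0 : 0 < s := by linarith
  have h := Real.log_le_sub_one_of_pos (x := s / 10 ^ 18) (by positivity)
  rw [Real.log_div (by positivity) (by positivity)] at h
  have h2 : Real.log (10 ^ 18 : ℝ) ≤ 60 * Real.log 2 := by
    rw [← Real.log_rpow (by norm_num)]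
    apply Real.log_le_log (by norm_num)
    norm_num
  have h3 := Real.log_two_lt_d9
  have h4 : Real.log s ≤ 0.0001 * s := by
    norm_num at *
    linarith
  rw [hlog, ← hsq]
  nlinarith

/-- For large `x` there is a prime in `(29 * x / 30, x]`. -/
lemma prime_large (x : ℝ) (hx : 2 * 10 ^ 36 ≤ x) :
    ∃ p : ℕ, p.Prime ∧ 29 * x / 30 < p ∧ (p : ℝ) ≤ x := by
  have h1 := (psi_final x (by linarith)).1
  have h2 := (psi_final (29 * x / 30) (by linarith)).2
  have h3 := Chebyshev.psi_sub_theta_le (x := x) (by linarith)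
  have h4 := sqrt_log_err x (by linarith)
  have h5 := Chebyshev.theta_le_psi (29 * x / 30)
  have hlt : Chebyshev.theta (29 * x / 30) < Chebyshev.theta x := by nlinarith
  by_contra hcon
  push Not at hcon
  apply absurd hlt
  rw [not_lt]
  rw [Chebyshev.theta_eq_sum_Icc, Chebyshev.theta_eq_sum_Icc]
  apply Finset.sum_le_sum_of_subset_of_nonneg
  · intro p hp
    simp only [Finset.mem_filter, Finset.mem_Icc] at hp ⊢
    refine ⟨⟨hp.1.1, ?_⟩, hp.2⟩
    have hpx : (p : ℝ) ≤ x := (Nat.le_floor_iff (by linarith)).1 hp.1.2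
    rw [Nat.le_floor_iff (by linarith)]
    by_contra hlt'
    push Not at hlt'
    have := hcon p hp.2 hlt'
    linarith
  · intro p hp _
    simp only [Finset.mem_filter] at hp
    exact Real.log_nonneg (by exact_mod_cast hp.2.one_le)


/-! ### Finite range: explicit chain of primes -/

/-- trial division with fuel -/
def tdChk (p : ℕ) : ℕ → ℕ → Bool
  | 0, _ => false
  | f + 1, d => Nat.blt p (d * d) || (!(Nat.beq (p % d) 0) && tdChk p f (d + 1))

lemma tdChk_sound (p : ℕ) (f d : ℕ) (h : tdChk p f d = true) :
    ∃ e, p < e * e ∧ ∀ c, d ≤ c → c < e → ¬ c ∣ p := by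
  induction f generalizing d with
  | zero => simp [tdChk] at h
  | succ f ih =>
    simp only [tdChk, Bool.or_eq_true, Bool.and_eq_true, Bool.not_eq_true'] at h
    rcases h with h | ⟨h1, h2⟩
    · refine ⟨d, by simpa [Nat.blt] using h, fun c h1 h2 => by omega⟩
    · obtain ⟨e, he, hc⟩ := ih (d + 1) h2
      refine ⟨e, he, fun c h3 h4 h5 => ?_⟩
      rcases Nat.eq_or_lt_of_le h3 with h6 | h6
      · subst h6
        have := Nat.mod_eq_zero_of_dvd h5
        rw [this] at h1
        simp at h1
      · exact hc c h6 h4 h5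

lemma tdChk_prime (p f : ℕ) (hp : 2 ≤ p) (h : tdChk p f 2 = true) : p.Prime := by
  obtain ⟨e, he, hc⟩ := tdChk_sound p f 2 h
  by_contra hn
  have h1 := Nat.minFac_sq_le_self (by omega) hn
  have h2 : 2 ≤ p.minFac := (Nat.minFac_prime (by omega)).two_le
  refine hc p.minFac h2 ?_ (Nat.minFac_dvd p)
  by_contra h3
  push Not at h3
  nlinarith

/-- repeated squaring mod p -/
def sqIter (p b : ℕ) : ℕ → ℕ
  | 0 => b % p
  | s + 1 => (sqIter p b s) ^ 2 % p

lemma sqIter_eq (p b s : ℕ) : sqIter p b s = b ^ (2 ^ s) % p := by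
  induction s with
  | zero => simp [sqIter]
  | succ s ih => rw [sqIter, ih, ← Nat.pow_mod, ← pow_mul, ← pow_succ]

lemma proth (k s b : ℕ) (hk0 : 0 < k) (hk : k < 2 ^ (s + 1))
    (h : sqIter (k * 2 ^ (s + 1) + 1) b s = k * 2 ^ (s + 1)) :
    (k * 2 ^ (s + 1) + 1).Prime := by
  set p := k * 2 ^ (s + 1) + 1 with hp
  have hpp : 0 < k * 2 ^ (s + 1) := by positivity
  by_contra hn
  have h1 := Nat.minFac_sq_le_self (by omega) hn
  have hq : p.minFac.Prime := Nat.minFac_prime (by omega)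
  have hqd := Nat.minFac_dvd p
  set q := p.minFac with hqdef
  have : Fact q.Prime := ⟨hq⟩
  have hodd : q ≠ 2 := by
    intro h2
    rw [h2] at hqd
    have : p = 2 * (k * 2 ^ s) + 1 := by rw [hp, pow_succ]; ring
    omega
  have hneg : (b : ZMod q) ^ (2 ^ s) = -1 := by
    rw [sqIter_eq] at h
    have h3 : (b ^ (2 ^ s) + 1) % p = 0 := by
      rw [Nat.add_mod, h]
      have : 1 % p = 1 := Nat.mod_eq_of_lt (by omega)
      rw [this, ← hp, Nat.mod_self]
    have h4 : q ∣ b ^ (2 ^ s) + 1 := hqd.trans (Nat.dvd_of_mod_eq_zero h3)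
    have h5 := (ZMod.natCast_eq_zero_iff _ _).2 h4
    push_cast at h5
    exact eq_neg_of_add_eq_zero_left h5
  have hne : (-1 : ZMod q) ≠ 1 := by
    have : Fact (2 < q) := ⟨by have := hq.two_le; omega⟩
    exact ZMod.neg_one_ne_one
  have hord : orderOf (b : ZMod q) = 2 ^ (s + 1) := by
    apply orderOf_eq_prime_pow
    · rw [hneg]; exact hne
    · rw [pow_succ, pow_mul, hneg]; norm_num
  have hb0 : (b : ZMod q) ≠ 0 := by
    intro h0
    rw [h0, zero_pow (by positivity)] at hneg
    have : (1 : ZMod q) = 0 := by linear_combination hneg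
    exact one_ne_zero this
  have hdvd : orderOf (b : ZMod q) ∣ q - 1 :=
    orderOf_dvd_of_pow_eq_one (ZMod.pow_card_sub_one_eq_one hb0)
  rw [hord] at hdvd
  have hle := Nat.le_of_dvd (by have := hq.two_le; omega) hdvd
  have hle2 : 2 ^ (s + 1) + 1 ≤ q := by have := hq.two_le; omega
  have : (2 ^ (s + 1) + 1) ^ 2 ≤ q ^ 2 := Nat.pow_le_pow_left hle2 2
  nlinarith

/-- `y` lies below some link of the chain -/
def Link (y : ℕ) : Prop := ∃ p q : ℕ, p.Prime ∧ p ≤ y ∧ y < q ∧ 29 * q ≤ 30 * p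

/-- chain of small primes ending at `t` -/
def smallChain (t : ℕ) : List ℕ → ℕ → Bool
  | [], p => Nat.beq p t
  | q :: l, p => Nat.ble (29 * q) (30 * p) && (Nat.ble 2 q && tdChk q 3000 2)
      && smallChain t l q

lemma smallChain_sound (t : ℕ) (l : List ℕ) (p : ℕ) (hp : p.Prime)
    (h : smallChain t l p = true) :
    t.Prime ∧ ∀ y, p ≤ y → y < t → Link y := by
  induction l generalizing p with
  | nil =>
    have : p = t := by simpa [smallChain] using h
    subst this
    exact ⟨hp, fun y h1 h2 => by omega⟩
  | cons q l ih =>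
    simp only [smallChain, Bool.and_eq_true, Nat.ble_eq] at h
    obtain ⟨⟨h1, h2, h3⟩, h4⟩ := h
    obtain ⟨h5, h6⟩ := ih q (tdChk_prime q _ h2 h3) h4
    refine ⟨h5, fun y hy1 hy2 => ?_⟩
    by_cases hy : y < q
    · exact ⟨p, q, hp, hy1, hy, h1⟩
    · exact h6 y (by omega) hy2

/-- chain of Proth primes `k * 2 ^ (s + 1) + 1` ending at `t` -/
def prothChain (t : ℕ) : List (ℕ × ℕ × ℕ) → ℕ → Bool
  | [], p => Nat.beq p t
  | (k, s, a) :: l, p =>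
      Nat.ble (29 * (k * 2 ^ (s + 1) + 1)) (30 * p) &&
      (Nat.blt 0 k && (Nat.blt k (2 ^ (s + 1)) &&
        Nat.beq (sqIter (k * 2 ^ (s + 1) + 1) (a ^ k) s) (k * 2 ^ (s + 1))))
      && prothChain t l (k * 2 ^ (s + 1) + 1)

lemma prothChain_sound (t : ℕ) (l : List (ℕ × ℕ × ℕ)) (p : ℕ) (hp : p.Prime)
    (h : prothChain t l p = true) :
    t.Prime ∧ ∀ y, p ≤ y → y < t → Link y := by
  induction l generalizing p with
  | nil =>
    have : p = t := by simpa [prothChain] using h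
    subst this
    exact ⟨hp, fun y h1 h2 => by omega⟩
  | cons e l ih =>
    obtain ⟨k, s, a⟩ := e
    simp only [prothChain, Bool.and_eq_true, Nat.ble_eq, Nat.blt_eq, Nat.beq_eq] at h
    obtain ⟨⟨h1, h2, h3, h3'⟩, h4⟩ := h
    obtain ⟨h5, h6⟩ := ih _ (proth k s _ h2 h3 h3') h4
    refine ⟨h5, fun y hy1 hy2 => ?_⟩
    by_cases hy : y < k * 2 ^ (s + 1) + 1
    · exact ⟨p, _, hp, hy1, hy, h1⟩
    · exact h6 y (by omega) hy2

lemma chain_small : smallChain 4292521 [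
  337, 347, 353, 359, 367, 379, 389, 401, 409, 421, 433, 443, 457, 467, 479, 491, 503, 509, 523,
  541, 557, 571, 587, 607, 619, 631, 647, 661, 683, 701, 719, 743, 761, 787, 811, 829, 857, 883,
  911, 941, 971, 997, 1031, 1063, 1097, 1129, 1163, 1201, 1237, 1279, 1321, 1361, 1399, 1447,
  1493, 1543, 1583, 1637, 1693, 1747, 1801, 1861, 1913, 1973, 2039, 2099, 2161, 2221, 2297,
  2371, 2447, 2531, 2617, 2707, 2797, 2887, 2971, 3067, 3169, 3271, 3373, 3469, 3583, 3701,
  3823, 3947, 4079, 4219, 4363, 4513, 4663, 4817, 4973, 5119, 5281, 5449, 5623, 5813, 6011,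
  6217, 6427, 6637, 6863, 7079, 7321, 7573, 7829, 8093, 8369, 8647, 8941, 9241, 9551, 9871,
  10211, 10559, 10909, 11279, 11657, 12049, 12457, 12853, 13291, 13729, 14197, 14683, 15187,
  15683, 16223, 16763, 17341, 17929, 18541, 19163, 19819, 20483, 21187, 21911, 22651, 23431,
  24229, 25057, 25919, 26801, 27701, 28649, 29633, 30649, 31699, 32789, 33911, 35069, 36277,
  37517, 38803, 40129, 41507, 42937, 44417, 45943, 47527, 49157, 50849, 52583, 54377, 56249,
  58171, 60169, 62233, 64373, 66587, 68881, 71249, 73699, 76231, 78857, 81569, 84377, 87281,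
  90289, 93383, 96601, 99929, 103357, 106921, 110603, 114407, 118343, 122401, 126613, 130973,
  135479, 140143, 144973, 149971, 155137, 160483, 166013, 171733, 177647, 183763, 190097,
  196643, 203419, 210421, 217667, 225167, 232919, 240943, 249233, 257797, 266683, 275837,
  285343, 295153, 305329, 315857, 326741, 337999, 349637, 361687, 374149, 387047, 400391,
  414179, 428429, 443189, 458449, 474241, 490591, 507503, 525001, 543097, 561809, 581177,
  601207, 621937, 643373, 665557, 688477, 712199, 736741, 762121, 788399, 815569, 843679,
  872761, 902849, 933979, 966157, 999451, 1033867, 1069517, 1106381, 1144529, 1183993, 1224809,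
  1267043, 1310723, 1355917, 1402603, 1450963, 1500991, 1552723, 1606261, 1661641, 1718933,
  1778197, 1839511, 1902931, 1968541, 2036393, 2106563, 2179187, 2254327, 2332061, 2412467,
  2495621, 2581673, 2670677, 2762761, 2857993, 2956531, 3058441, 3163879, 3272963, 3385817,
  3502567, 3623287, 3748219, 3877451, 4011127, 4149437, 4292521] 331 = true := by
  decide +kernel

lemma chain_proth0 : prothChain 518946817 [
  (1083,11,7), (1111,11,3), (1146,11,5), (1183,11,3), (1198,11,3), (1237,11,3), (1278,11,7),
  (1321,11,3), (1365,11,23), (1411,11,3), (1453,11,3), (1503,11,7), (1543,11,3), (1596,11,5),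
  (1648,11,3), (1698,11,7), (1755,11,7), (1815,11,7), (1873,11,3), (1935,11,11), (1998,11,11),
  (2061,11,5), (2128,11,3), (2200,11,3), (2251,11,3), (2320,11,3), (2388,11,17), (2460,11,11),
  (2535,11,11), (2622,11,5), (2707,11,3), (2800,11,3), (2871,11,5), (2961,11,5), (3057,11,5),
  (3157,11,3), (3258,11,17), (3361,11,3), (3466,11,3), (3585,11,11), (3703,11,3), (3816,11,5),
  (3937,11,3), (4071,11,5), (2091,12,5), (2163,12,5), (2223,12,5), (2298,12,5), (2370,12,11),
  (2451,12,5), (2529,12,7), (2591,12,3), (2679,12,23), (2771,12,3), (2858,12,3), (2954,12,3),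
  (3045,12,11), (3149,12,3), (3246,12,5), (3354,12,7), (3459,12,7), (3576,12,5), (3686,12,3),
  (3813,12,5), (3941,12,3), (4071,12,5), (4211,12,3), (4356,12,5), (4493,12,3), (4631,12,3),
  (4788,12,5), (4935,12,11), (5103,12,5), (5268,12,5), (5424,12,7), (5604,12,11), (5784,12,7),
  (5978,12,3), (6183,12,5), (6386,12,3), (6600,12,7), (6804,12,13), (7035,12,13), (7266,12,5),
  (7505,12,3), (7763,12,3), (8030,12,3), (4134,13,5), (4258,13,3), (4393,13,3), (4543,13,3),
  (4690,13,3), (4843,13,3), (5002,13,3), (5170,13,3), (5343,13,5), (5520,13,7), (5698,13,3),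
  (5889,13,5), (6090,13,23), (6300,13,11), (6498,13,5), (6717,13,7), (6948,13,5), (7165,13,3),
  (7410,13,7), (7662,13,7), (7923,13,5), (8194,13,3), (8449,13,3), (8715,13,13), (9010,13,3),
  (9318,13,5), (9628,13,3), (9942,13,11), (10269,13,5), (10612,13,3), (10977,13,7),
  (11353,13,3), (11724,13,5), (12127,13,3), (12517,13,3), (12940,13,3), (13365,13,13),
  (13825,13,3), (14283,13,5), (14760,13,7), (15267,13,11), (15793,13,3), (16330,13,3),
  (8436,14,11), (8712,14,5), (9012,14,5), (9317,14,3), (9629,14,3), (9959,14,3), (10302,14,5),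
  (10647,14,5), (11007,14,5), (11382,14,5), (11769,14,5), (12161,14,3), (12546,14,7),
  (12947,14,3), (13392,14,5), (13841,14,3), (14310,14,7), (14801,14,3), (15311,14,3),
  (15837,14,5)] 4292521 = true := by
  decide +kernel

lemma chain_proth1 : prothChain 77741424641 [
  (16377,14,5), (16926,14,19), (17484,14,5), (18075,14,11), (18695,14,3), (19332,14,5),
  (19985,14,3), (20669,14,3), (21369,14,5), (22094,14,3), (22850,14,3), (23615,14,3),
  (24420,14,7), (25259,14,3), (26121,14,7), (27015,14,7), (27927,14,5), (28880,14,3),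
  (29870,14,3), (30894,14,5), (31937,14,3), (16498,15,3), (17046,15,5), (17626,15,3),
  (18225,15,13), (18853,15,3), (19497,15,5), (20160,15,11), (20848,15,3), (21565,15,3),
  (22308,15,7), (23070,15,11), (23862,15,5), (24681,15,5), (25521,15,5), (26398,15,3),
  (27276,15,5), (28216,15,3), (29182,15,3), (30183,15,7), (31215,15,7), (32272,15,3),
  (16688,16,3), (17261,16,3), (17849,16,3), (18459,16,11), (19085,16,3), (19719,16,11),
  (20394,16,7), (21051,16,5), (21776,16,3), (22523,16,3), (23289,16,13), (24084,16,7),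
  (24905,16,3), (25733,16,3), (26615,16,3), (27513,16,5), (28461,16,5), (29438,16,3),
  (30450,16,17), (31490,16,3), (32570,16,3), (16828,17,3), (17407,17,3), (17998,17,3),
  (18615,17,7), (19252,17,3), (19909,17,3), (20590,17,3), (21289,17,3), (22017,17,7),
  (22774,17,3), (23535,17,11), (24334,17,3), (25152,17,11), (26017,17,3), (26908,17,3),
  (27828,17,5), (28753,17,3), (29733,17,5), (30742,17,3), (31792,17,3), (16431,18,7),
  (16979,18,3), (17540,18,3), (18144,18,5), (18767,18,3), (19412,18,3), (20052,18,5),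
  (20736,18,7), (21432,18,5), (22167,18,5), (22929,18,5), (23685,18,11), (24494,18,3),
  (25337,18,3), (26180,18,3), (27077,18,3), (28002,18,5), (28967,18,3), (29960,18,3),
  (30977,18,3), (32040,18,7), (16566,19,5), (17121,19,5), (17691,19,5), (18297,19,5),
  (18927,19,5), (19573,19,3), (20227,19,3), (20920,19,3), (21630,19,17), (22353,19,11),
  (23113,19,3), (23898,19,11), (24712,19,3), (25515,19,11), (26382,19,5), (27288,19,23),
  (28228,19,3), (29200,19,3), (30202,19,3), (31243,19,3), (32287,19,3), (16698,20,5),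
  (17265,20,11), (17805,20,7), (18410,20,3), (19034,20,3), (19688,20,3), (20354,20,3),
  (21029,20,3), (21744,20,7), (22479,20,7), (23235,20,7), (24036,20,5), (24860,20,3),
  (25704,20,11), (26589,20,13), (27458,20,3), (28395,20,23), (29358,20,5), (30366,20,5),
  (31409,20,3), (32469,20,11), (16765,21,3), (17332,21,3), (17929,21,3), (18535,21,3)] 518946817 = true := by
  decide +kernel

lemma chain_proth2 : prothChain 11429981716481 [
  (19168,21,3), (19815,21,11), (20487,21,11), (21184,21,3), (21903,21,5), (22644,21,5),
  (23412,21,11), (24199,21,3), (25024,21,3), (25860,21,7), (26739,21,5), (27654,21,5),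
  (28599,21,5), (29562,21,7), (30568,21,3), (31620,21,7), (32709,21,5), (16901,22,3),
  (17465,22,3), (18050,22,3), (18662,22,3), (19284,22,5), (19917,22,5), (20597,22,3),
  (21276,22,7), (21965,22,3), (22695,22,7), (23474,22,3), (24275,22,3), (25112,22,3),
  (25976,22,3), (26835,22,7), (27720,22,17), (28652,22,3), (29639,22,3), (30659,22,3),
  (31704,22,5), (16380,23,11), (16930,23,3), (17502,23,5), (18105,23,11), (18721,23,3),
  (19366,23,3), (20017,23,3), (20707,23,3), (21420,23,19), (22135,23,3), (22872,23,5),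
  (23650,23,3), (24441,23,5), (25246,23,3), (26098,23,3), (26992,23,3), (27907,23,3),
  (28861,23,3), (29853,23,7), (30870,23,11), (31915,23,3), (16505,24,3), (17045,24,3),
  (17631,24,5), (18216,24,5), (18818,24,3), (19448,24,3), (20105,24,3), (20783,24,3),
  (21498,24,5), (22239,24,13), (22988,24,3), (23780,24,3), (24578,24,3), (25409,24,3),
  (26255,24,3), (27158,24,3), (28083,24,5), (29051,24,3), (30051,24,5), (31085,24,3),
  (32096,24,3), (16582,25,3), (17095,25,3), (17679,25,5), (18250,25,3), (18864,25,5),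
  (19512,25,7), (20170,25,3), (20860,25,3), (21574,25,3), (22317,25,7), (23085,25,13),
  (23874,25,5), (24697,25,3), (25530,25,7), (26404,25,3), (27313,25,3), (28245,25,11),
  (29215,25,3), (30208,25,3), (31230,25,7), (32305,25,3), (16707,26,5), (17277,26,5),
  (17826,26,7), (18426,26,7), (19010,26,3), (19661,26,3), (20336,26,3), (21021,26,17),
  (21726,26,7), (22470,26,11), (23234,26,3), (24011,26,3), (24810,26,7), (25646,26,3),
  (26526,26,19), (27435,26,7), (28365,26,11), (29342,26,3), (30327,26,5), (31355,26,3),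
  (32400,26,7), (16750,27,3), (17313,27,7), (17907,27,5), (18507,27,5), (19131,27,5),
  (19786,27,3), (20460,27,7), (21163,27,3), (21873,27,17), (22603,27,3), (23353,27,3),
  (24157,27,3), (24975,27,7), (25836,27,5), (26716,27,3), (27615,27,17), (28545,27,7),
  (29526,27,5), (30526,27,3), (31576,27,3), (32646,27,5), (16871,28,3), (17430,28,29),
  (18021,28,5), (18636,28,5), (19265,28,3), (19904,28,3), (20586,28,5), (21290,28,3)] 77741424641 = true := by
  decide +kernel

lemma chain_proth3 : prothChain 1671326393696257 [
  (21984,28,7), (22736,28,3), (23436,28,5), (24224,28,3), (25055,28,3), (25901,28,3),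
  (26786,28,3), (27701,28,3), (28646,28,3), (29625,28,7), (30641,28,3), (31676,28,3),
  (16359,29,5), (16915,29,3), (17497,29,3), (18075,29,19), (18693,29,5), (19320,29,17),
  (19978,29,3), (20652,29,7), (21364,29,3), (22092,29,19), (22849,29,3), (23620,29,3),
  (24432,29,7), (25243,29,3), (26104,29,3), (26965,29,3), (27892,29,3), (28837,29,3),
  (29829,29,5), (30840,29,7), (31902,29,17), (16500,30,7), (17054,30,3), (17630,30,3),
  (18234,30,5), (18852,30,5), (19469,30,3), (20099,30,3), (20790,30,13), (21504,30,5),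
  (22245,30,7), (23010,30,7), (23790,30,11), (24609,30,5), (25436,30,3), (26310,30,11),
  (27209,30,3), (28142,30,3), (29069,30,3), (30066,30,7), (31100,30,3), (32160,30,7),
  (16633,31,3), (17193,31,7), (17770,31,3), (18328,31,3), (18958,31,3), (19597,31,3),
  (20272,31,3), (20968,31,3), (21688,31,3), (22410,31,7), (23181,31,5), (23970,31,19),
  (24766,31,3), (25608,31,17), (26461,31,3), (27372,31,5), (28305,31,7), (29280,31,13),
  (30282,31,5), (31317,31,5), (32395,31,3), (16739,32,3), (17306,32,3), (17820,32,7),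
  (18420,32,19), (19040,32,3), (19689,32,7), (20364,32,13), (21066,32,5), (21788,32,3),
  (22535,32,3), (23300,32,3), (24101,32,3), (24918,32,5), (25751,32,3), (26636,32,3),
  (27510,32,13), (28443,32,5), (29421,32,5), (30431,32,3), (31448,32,3), (32526,32,5),
  (16807,33,3), (17380,33,3), (17967,33,11), (18580,33,3), (19174,33,3), (19833,33,5),
  (20502,33,7), (21187,33,3), (21897,33,7), (22645,33,3), (23400,33,7), (24193,33,3),
  (25024,33,3), (25884,33,5), (26775,33,11), (27670,33,3), (28575,33,7), (29527,33,3),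
  (30508,33,3), (31533,33,5), (32604,33,5), (16862,34,3), (17387,34,3), (17976,34,11),
  (18552,34,5), (19191,34,7), (19844,34,3), (20526,34,13), (21225,34,7), (21951,34,11),
  (22686,34,11), (23432,34,3), (24207,34,5), (25017,34,5), (25875,34,7), (26751,34,7),
  (27672,34,5), (28625,34,3), (29607,34,5), (30621,34,7), (31674,34,5), (32760,34,11),
  (16920,35,11), (17482,35,3), (18063,35,11), (18652,35,3), (19290,35,7), (19950,35,29),
  (20580,35,13), (21262,35,3), (21991,35,3), (22741,35,3), (23517,35,5), (24321,35,5)] 11429981716481 = true := by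
  decide +kernel

lemma chain_proth4 : prothChain 243950843877916673 [
  (25135,35,3), (25980,35,13), (26866,35,3), (27783,35,11), (28732,35,3), (29685,35,7),
  (30700,35,3), (31755,35,31), (16403,36,3), (16956,36,5), (17528,36,3), (18125,36,3),
  (18738,36,5), (19373,36,3), (20040,36,7), (20720,36,3), (21419,36,3), (22121,36,3),
  (22863,36,5), (23651,36,3), (24444,36,17), (25283,36,3), (26154,36,7), (27054,36,7),
  (27971,36,3), (28893,36,5), (29885,36,3), (30914,36,3), (31976,36,3), (16530,37,7),
  (17070,37,7), (17655,37,7), (18232,37,3), (18859,37,3), (19480,37,3), (20128,37,3),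
  (20817,37,23), (21513,37,5), (22248,37,5), (22990,37,3), (23782,37,3), (24598,37,3),
  (25434,37,5), (26260,37,3), (27163,37,3), (28078,37,3), (29022,37,11), (30010,37,3),
  (31039,37,3), (32077,37,3), (16587,38,5), (17157,38,5), (17736,38,7), (18330,38,7),
  (18932,38,3), (19535,38,3), (20190,38,7), (20885,38,3), (21597,38,5), (22337,38,3),
  (23075,38,3), (23870,38,3), (24689,38,3), (25502,38,3), (26381,38,3), (27261,38,11),
  (28197,38,5), (29156,38,3), (30150,38,11), (31157,38,3), (32216,38,3), (16630,39,3),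
  (17200,39,3), (17791,39,3), (18381,39,5), (19006,39,3), (19657,39,3), (20313,39,7),
  (20985,39,7), (21693,39,11), (22435,39,3), (23190,39,7), (23983,39,3), (24796,39,3),
  (25648,39,3), (26530,39,3), (27426,39,5), (28362,39,5), (29335,39,3), (30328,39,3),
  (31341,39,5), (32415,39,11), (16754,40,3), (17328,40,5), (17919,40,13), (18528,40,5),
  (19155,40,7), (19790,40,3), (20448,40,5), (21150,40,7), (21864,40,7), (22595,40,3),
  (23354,40,3), (24153,40,5), (24951,40,5), (25808,40,3), (26676,40,5), (27584,40,3),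
  (28521,40,5), (29480,40,3), (30495,40,7), (31545,40,7), (32610,40,7), (16864,41,3),
  (17428,41,3), (18025,41,3), (18622,41,3), (19237,41,3), (19897,41,3), (20568,41,5),
  (21268,41,3), (21990,41,13), (22705,41,3), (23469,41,5), (24249,41,5), (25083,41,5),
  (25947,41,7), (26839,41,3), (27735,41,11), (28689,41,5), (29640,41,7), (30649,41,3),
  (31672,41,3), (32739,41,5), (16919,42,3), (17486,42,3), (18080,42,3), (18699,42,5),
  (19307,42,3), (19944,42,5), (20621,42,3), (21329,42,3), (22056,42,7), (22815,42,7),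
  (23546,42,3), (24290,42,3), (25092,42,5), (25956,42,11), (26849,42,3), (27734,42,3)] 1671326393696257 = true := by
  decide +kernel

lemma chain_proth5 : prothChain 34553868141000130561 [
  (28677,42,5), (29657,42,3), (30671,42,3), (31680,42,17), (16362,43,5), (16926,43,5),
  (17473,43,3), (18018,43,17), (18630,43,7), (19261,43,3), (19911,43,5), (20590,43,3),
  (21286,43,3), (22015,43,3), (22770,43,17), (23545,43,3), (24315,43,7), (25153,43,3),
  (26016,43,5), (26898,43,7), (27801,43,5), (28755,43,11), (29733,43,7), (30738,43,7),
  (31651,43,3), (32707,43,3), (16910,44,3), (17484,44,7), (18068,44,3), (18663,44,5),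
  (19173,44,5), (19829,44,3), (20498,44,3), (21180,44,7), (21896,44,3), (22641,44,5),
  (23399,44,3), (24143,44,3), (24944,44,3), (25790,44,3), (26670,44,11), (27573,44,5),
  (28494,44,7), (29468,44,3), (30479,44,3), (31529,44,3), (32603,44,3), (16854,45,5),
  (17422,45,3), (18019,45,3), (18559,45,3), (19188,45,5), (19842,45,13), (20517,45,11),
  (21222,45,11), (21949,45,3), (22680,45,17), (23428,45,3), (24207,45,7), (25012,45,3),
  (25864,45,3), (26733,45,5), (27648,45,5), (28600,45,3), (29535,45,7), (30552,45,11),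
  (31603,45,3), (32692,45,3), (16880,46,3), (17430,46,11), (18027,46,5), (18642,46,5),
  (19284,46,5), (19937,46,3), (20586,46,13), (21290,46,3), (22001,46,3), (22754,46,3),
  (23474,46,3), (24279,46,5), (25080,46,17), (25929,46,5), (26816,46,3), (27719,46,3),
  (28671,46,17), (29655,46,7), (30674,46,3), (31721,46,3), (16396,47,3), (16957,47,3),
  (17512,47,3), (18097,47,3), (18690,47,37), (19300,47,3), (19948,47,3), (20626,47,3),
  (21312,47,5), (22038,47,7), (22761,47,5), (23487,47,5), (24277,47,3), (25110,47,13),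
  (25968,47,7), (26860,47,3), (27753,47,7), (28681,47,3), (29668,47,3), (30636,47,5),
  (31677,47,5), (16340,48,3), (16881,48,5), (17463,48,5), (18054,48,7), (18615,48,7),
  (19224,48,7), (19863,48,5), (20540,48,3), (21236,48,3), (21939,48,7), (22650,48,11),
  (23426,48,3), (24221,48,3), (25040,48,3), (25871,48,3), (26753,48,3), (27648,48,5),
  (28586,48,3), (29565,48,13), (30524,48,3), (31554,48,13), (32639,48,3), (16860,49,7),
  (17419,49,3), (18019,49,3), (18610,49,3), (19239,49,5), (19902,49,7), (20572,49,3),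
  (21274,49,3), (21997,49,3), (22735,49,3), (23514,49,5), (24324,49,5), (25144,49,3),
  (25998,49,5), (26844,49,5), (27735,49,7), (28690,49,3), (29679,49,5), (30690,49,13)] 243950843877916673 = true := by
  decide +kernel

lemma chain_proth6 : prothChain 4897898781946037665793 [
  (31747,49,3), (16374,50,5), (16937,50,3), (17489,50,3), (18084,50,5), (18692,50,3),
  (19325,50,3), (19967,50,3), (20646,50,11), (21327,50,5), (22059,50,5), (22815,50,7),
  (23576,50,3), (24356,50,3), (25194,50,5), (26057,50,3), (26952,50,5), (27849,50,5),
  (28806,50,11), (29789,50,3), (30777,50,5), (31805,50,3), (16426,51,3), (16968,51,29),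
  (17526,51,5), (18118,51,3), (18720,51,7), (19360,51,3), (20007,51,5), (20683,51,3),
  (21393,51,7), (22128,51,7), (22881,51,5), (23646,51,5), (24448,51,3), (25291,51,3),
  (26131,51,3), (27022,51,3), (27906,51,5), (28858,51,3), (29835,51,7), (30778,51,3),
  (31813,51,3), (16419,52,7), (16974,52,19), (17544,52,19), (18141,52,5), (18708,52,5),
  (19350,52,13), (19995,52,7), (20661,52,5), (21368,52,3), (22086,52,5), (22845,52,7),
  (23631,52,5), (24434,52,3), (25239,52,7), (26084,52,3), (26981,52,3), (27891,52,5),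
  (28839,52,11), (29831,52,3), (30836,52,3), (31886,52,3), (16483,53,3), (17032,53,3),
  (17595,53,7), (18187,53,3), (18810,53,13), (19443,53,5), (20079,53,5), (20703,53,5),
  (21403,53,3), (22099,53,3), (22834,53,3), (23590,53,3), (24403,53,3), (25243,53,3),
  (26113,53,3), (26994,53,5), (27904,53,3), (28843,53,3), (29835,53,29), (30853,53,3),
  (31882,53,3), (16485,54,17), (17009,54,3), (17562,54,5), (18141,54,11), (18764,54,3),
  (19385,54,3), (20042,54,3), (20726,54,3), (21426,54,7), (22152,54,5), (22854,54,5),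
  (23624,54,3), (24420,54,13), (25247,54,3), (26105,54,3), (26985,54,11), (27914,54,3),
  (28862,54,3), (29835,54,7), (30860,54,3), (31914,54,5), (16488,55,7), (17046,55,5),
  (17598,55,23), (18157,55,3), (18777,55,5), (19417,55,3), (20086,55,3), (20778,55,13),
  (21466,55,3), (22135,55,3), (22882,55,3), (23625,55,11), (24438,55,7), (25252,55,3),
  (26110,55,3), (26938,55,3), (27835,55,3), (28737,55,5), (29701,55,3), (30717,55,5),
  (31747,55,3), (16418,56,3), (16964,56,3), (17486,56,3), (18060,56,23), (18678,56,5),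
  (19301,56,3), (19953,56,5), (20640,56,7), (21350,56,3), (22076,56,3), (22824,56,7),
  (23579,56,3), (24383,56,3), (25221,56,5), (26043,56,5), (26934,56,7), (27849,56,11),
  (28796,56,3), (29766,56,5), (30765,56,19), (31824,56,7), (16444,57,3), (16993,57,3)] 34553868141000130561 = true := by
  decide +kernel

lemma chain_proth7 : prothChain 664599295487607725621249 [
  (17577,57,13), (18093,57,5), (18667,57,3), (19300,57,3), (19885,57,3), (20560,57,3),
  (21258,57,5), (21987,57,11), (22740,57,11), (23508,57,5), (24249,57,5), (25053,57,5),
  (25873,57,3), (26752,57,3), (27633,57,5), (28537,57,3), (29512,57,3), (30514,57,3),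
  (31549,57,3), (32563,57,3), (16835,58,3), (17409,58,5), (18000,58,7), (18584,58,3),
  (19217,58,3), (19802,58,3), (20474,58,3), (21177,58,5), (21846,58,29), (22562,58,3),
  (23337,58,5), (24131,58,3), (24921,58,7), (25752,58,5), (26639,58,3), (27555,58,7),
  (28476,58,19), (29451,58,17), (30459,58,5), (31460,58,3), (32507,58,3), (16786,59,3),
  (17350,59,3), (17941,59,3), (18517,59,3), (19152,59,5), (19803,59,13), (20421,59,5),
  (21091,59,3), (21793,59,3), (22537,59,3), (23292,59,5), (24085,59,3), (24888,59,11),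
  (25737,59,5), (26583,59,7), (27451,59,3), (28351,59,3), (29296,59,3), (30270,59,7),
  (31311,59,5), (32380,59,3), (16746,60,5), (17295,60,11), (17879,60,3), (18459,60,17),
  (19094,60,3), (19734,60,7), (20393,60,3), (21069,60,7), (21771,60,5), (22476,60,5),
  (23195,60,3), (23994,60,11), (24819,60,11), (25661,60,3), (26514,60,13), (27426,60,5),
  (28364,60,3), (29288,60,3), (30251,60,3), (31254,60,7), (32321,60,3), (16689,61,5),
  (17247,61,11), (17838,61,5), (18435,61,7), (18955,61,3), (19575,61,7), (20250,61,11),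
  (20934,61,5), (21655,61,3), (22378,61,3), (23127,61,11), (23908,61,3), (24649,61,3),
  (25494,61,5), (26370,61,7), (27279,61,5), (28207,61,3), (29164,61,3), (30153,61,5),
  (31167,61,7), (32229,61,5), (16602,62,5), (17147,62,3), (17706,62,11), (18267,62,5),
  (18896,62,3), (19511,62,3), (20181,62,11), (20841,62,7), (21539,62,3), (22247,62,3),
  (23007,62,5), (23769,62,5), (24584,62,3), (25391,62,3), (26244,62,5), (27107,62,3),
  (28022,62,3), (28974,62,5), (29970,62,13), (30999,62,5), (32051,62,3), (16576,63,3),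
  (17137,63,3), (17703,63,11), (18283,63,3), (18913,63,3), (19557,63,5), (20215,63,3),
  (20878,63,3), (21592,63,3), (22216,63,3), (22930,63,3), (23658,63,11), (24442,63,3),
  (25248,63,7), (26110,63,3), (26938,63,3), (27796,63,3), (28711,63,3), (29668,63,3),
  (30660,63,13), (31635,63,7), (32668,63,3), (16890,64,11), (17459,64,3), (18014,64,3)] 4897898781946037665793 = true := by
  decide +kernel

lemma chain_proth8 : prothChain 89833577603629260900139009 [
  (18609,64,7), (19239,64,7), (19895,64,3), (20519,64,3), (21206,64,3), (21903,64,5),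
  (22658,64,3), (23424,64,11), (24174,64,7), (24983,64,3), (25844,64,3), (26684,64,3),
  (27581,64,3), (28479,64,7), (29420,64,3), (30374,64,3), (31418,64,3), (32439,64,7),
  (16774,65,3), (17328,65,5), (17907,65,13), (18454,65,3), (19090,65,3), (19744,65,3),
  (20415,65,17), (21072,65,7), (21765,65,7), (22482,65,7), (23224,65,3), (23998,65,3),
  (24823,65,3), (25617,65,7), (26485,65,3), (27325,65,3), (28240,65,3), (29188,65,3),
  (30193,65,3), (31218,65,5), (32265,65,7), (16671,66,11), (17186,66,3), (17766,66,11),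
  (18275,66,3), (18810,66,7), (19457,66,3), (20082,66,5), (20741,66,3), (21432,66,5),
  (22161,66,7), (22856,66,3), (23640,66,7), (24197,66,3), (25031,66,3), (25860,66,7),
  (26751,66,13), (27662,66,3), (28566,66,7), (29540,66,3), (30554,66,3), (31607,66,3),
  (32690,66,3), (16905,67,11), (17467,67,3), (18060,67,11), (18648,67,11), (19266,67,5),
  (19888,67,3), (20568,67,11), (21253,67,3), (21951,67,5), (22680,67,11), (23446,67,3),
  (24241,67,3), (25068,67,7), (25927,67,3), (26791,67,3), (27708,67,13), (28648,67,3),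
  (29635,67,3), (30615,67,7), (31630,67,3), (32715,67,7), (16908,68,5), (17486,68,3),
  (18008,68,3), (18560,68,3), (19148,68,3), (19799,68,3), (20465,68,3), (21131,68,3),
  (21843,68,5), (22596,68,5), (23336,68,3), (24134,68,3), (24911,68,3), (25751,68,3),
  (26633,68,3), (27548,68,3), (28343,68,3), (29270,68,3), (30255,68,13), (31280,68,3),
  (32333,68,3), (16689,69,5), (17259,69,5), (17842,69,3), (18442,69,3), (19065,69,13),
  (19710,69,11), (20370,69,11), (20988,69,5), (21700,69,3), (22432,69,3), (23193,69,5),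
  (23982,69,19), (24807,69,7), (25654,69,3), (26458,69,3), (27370,69,3), (28303,69,3),
  (29250,69,11), (30237,69,11), (31227,69,11), (32298,69,5), (16701,70,11), (17276,70,3),
  (17861,70,3), (18456,70,7), (19077,70,5), (19734,70,5), (20411,70,3), (21104,70,3),
  (21797,70,3), (22529,70,3), (23261,70,3), (24054,70,5), (24861,70,7), (25710,70,11),
  (26567,70,3), (27474,70,5), (28421,70,3), (29396,70,3), (30401,70,3), (31370,70,3),
  (32439,70,5), (16740,71,19), (17313,71,7), (17890,71,3), (18453,71,13), (19023,71,7)] 664599295487607725621249 = true := by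
  decide +kernel

lemma chain_proth9 : prothChain 12087444807416869803299700737 [
  (19647,71,5), (20290,71,3), (20988,71,7), (21616,71,3), (22330,71,3), (23088,71,7),
  (23877,71,5), (24691,71,3), (25450,71,3), (26317,71,3), (27153,71,11), (28086,71,5),
  (29043,71,11), (30025,71,3), (30997,71,3), (32065,71,3), (16563,72,5), (17123,72,3),
  (17624,72,3), (18216,72,5), (18834,72,11), (19461,72,5), (20124,72,7), (20705,72,3),
  (21369,72,11), (22100,72,3), (22779,72,7), (23538,72,5), (24330,72,11), (25163,72,3),
  (26013,72,5), (26859,72,11), (27785,72,3), (28728,72,5), (29709,72,7), (30669,72,7),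
  (31683,72,5), (16380,73,11), (16915,73,3), (17493,73,5), (18094,73,3), (18715,73,3),
  (19344,73,5), (20005,73,3), (20680,73,3), (21384,73,5), (22119,73,5), (22863,73,5),
  (23635,73,3), (24447,73,7), (25260,73,7), (26112,73,11), (27010,73,3), (27922,73,3),
  (28779,73,5), (29752,73,3), (30762,73,7), (31798,73,3), (16419,74,5), (16935,74,7),
  (17477,74,3), (18047,74,3), (18659,74,3), (19275,74,7), (19896,74,7), (20577,74,5),
  (21285,74,7), (21936,74,7), (22677,74,5), (23451,74,11), (24239,74,3), (25064,74,3),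
  (25911,74,7), (26804,74,3), (27722,74,3), (28676,74,3), (29655,74,11), (30630,74,7),
  (31536,74,11), (32600,74,3), (16843,75,3), (17326,75,3), (17917,75,3), (18523,75,3),
  (19161,75,5), (19815,75,23), (20496,75,5), (21193,75,3), (21910,75,3), (22621,75,3),
  (23368,75,3), (24166,75,3), (24973,75,3), (25831,75,3), (26713,75,3), (27516,75,5),
  (28447,75,3), (29383,75,3), (30387,75,5), (31357,75,3), (32377,75,3), (16724,76,3),
  (17300,76,3), (17885,76,3), (18495,76,7), (19104,76,7), (19716,76,5), (20381,76,3),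
  (21045,76,7), (21755,76,3), (22445,76,3), (23199,76,7), (23949,76,13), (24746,76,3),
  (25563,76,5), (26441,76,3), (27278,76,3), (28106,76,3), (29066,76,3), (30023,76,3),
  (31038,76,5), (32049,76,7), (16555,77,3), (17025,77,13), (17578,77,3), (18165,77,11),
  (18778,77,3), (19419,77,5), (20023,77,3), (20683,77,3), (21385,77,3), (22093,77,3),
  (22822,77,3), (23572,77,3), (24342,77,13), (25138,77,3), (25999,77,3), (26857,77,3),
  (27780,77,7), (28723,77,3), (29713,77,3), (30657,77,7), (31692,77,23), (16385,78,3),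
  (16940,78,3), (17511,78,11), (18101,78,3), (18711,78,13), (19352,78,3), (19997,78,3)] 89833577603629260900139009 = true := by
  decide +kernel

lemma chain_proth10 : prothChain 1548972474155832068967529185281 [
  (20679,78,5), (21317,78,3), (22049,78,3), (22782,78,5), (23517,78,5), (24309,78,5),
  (25116,78,11), (25965,78,7), (26847,78,5), (27761,78,3), (28709,78,3), (29694,78,5),
  (30690,78,7), (31725,78,7), (16386,79,5), (16933,79,3), (17472,79,5), (18057,79,5),
  (18621,79,5), (19215,79,11), (19825,79,3), (20500,79,3), (21195,79,11), (21913,79,3),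
  (22663,79,3), (23383,79,3), (24171,79,5), (24993,79,7), (25846,79,3), (26733,79,13),
  (27640,79,3), (28585,79,3), (29521,79,3), (30507,79,5), (31486,79,3), (32466,79,5),
  (16784,80,3), (17309,80,3), (17874,80,11), (18435,80,7), (19061,80,3), (19703,80,3),
  (20345,80,3), (21035,80,3), (21660,80,7), (22400,80,3), (23154,80,7), (23928,80,5),
  (24686,80,3), (25523,80,3), (26379,80,13), (27224,80,3), (28161,80,5), (29058,80,5),
  (30026,80,3), (31056,80,5), (32109,80,17), (16587,81,11), (17158,81,3), (17742,81,11),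
  (18325,81,3), (18753,81,5), (19399,81,3), (20022,81,7), (20712,81,7), (21417,81,17),
  (22149,81,5), (22909,81,3), (23697,81,7), (24480,81,7), (25324,81,3), (26164,81,3),
  (27064,81,3), (27979,81,3), (28929,81,5), (29874,81,5), (30903,81,5), (31957,81,3),
  (16461,82,7), (17009,82,3), (17502,82,5), (18026,82,3), (18545,82,3), (19182,82,5),
  (19757,82,3), (20429,82,3), (21039,82,5), (21702,82,5), (22395,82,29), (23145,82,7),
  (23891,82,3), (24674,82,3), (25514,82,3), (26366,82,3), (27257,82,3), (28149,82,5),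
  (29046,82,7), (29952,82,5), (30944,82,3), (31941,82,11), (16510,83,3), (17071,83,3),
  (17628,83,7), (18217,83,3), (18838,83,3), (19453,83,3), (20046,83,5), (20731,83,3),
  (21432,83,5), (22038,83,7), (22740,83,7), (23511,83,5), (24291,83,5), (25125,83,7),
  (25965,83,7), (26856,83,5), (27765,83,11), (28710,83,13), (29673,83,13), (30675,83,17),
  (31698,83,7), (16335,84,13), (16808,84,3), (17364,84,11), (17943,84,5), (18551,84,3),
  (19175,84,3), (19733,84,3), (20405,84,3), (21104,84,3), (21806,84,3), (22401,84,5),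
  (23154,84,11), (23895,84,19), (24698,84,3), (25536,84,5), (26229,84,11), (27036,84,5),
  (27920,84,3), (28806,84,5), (29766,84,5), (30758,84,3), (31814,84,3), (16453,85,3),
  (17014,85,3), (17599,85,3), (18199,85,3), (18789,85,5), (19420,85,3), (20020,85,3)] 12087444807416869803299700737 = true := by
  decide +kernel

lemma chain_proth11 : prothChain 200239277234488830225483141480449 [
  (20703,85,5), (21370,85,3), (22102,85,3), (22813,85,3), (23569,85,3), (24354,85,5),
  (25155,85,7), (26007,85,11), (26889,85,5), (27799,85,3), (28732,85,3), (29637,85,11),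
  (30639,85,5), (31674,85,5), (32745,85,13), (16922,86,3), (17495,86,3), (18077,86,3),
  (18695,86,3), (19230,86,17), (19712,86,3), (20295,86,7), (20994,86,5), (21669,86,5),
  (22352,86,3), (23055,86,7), (23822,86,3), (24594,86,5), (25419,86,5), (26222,86,3),
  (27122,86,3), (28056,86,11), (28982,86,3), (29927,86,3), (30954,86,5), (31977,86,5),
  (16522,87,3), (17031,87,5), (17485,87,3), (18082,87,3), (18705,87,7), (19258,87,3),
  (19902,87,5), (20572,87,3), (21273,87,17), (22002,87,5), (22743,87,11), (23496,87,5),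
  (24277,87,3), (25110,87,7), (25948,87,3), (26815,87,3), (27732,87,5), (28606,87,3),
  (29590,87,3), (30610,87,3), (31641,87,5), (32718,87,11), (16871,88,3), (17424,88,7),
  (17996,88,3), (18563,88,3), (19148,88,3), (19803,88,5), (20471,88,3), (21150,88,7),
  (21864,88,7), (22556,88,3), (23319,88,11), (24006,88,5), (24830,88,3), (25658,88,3),
  (26474,88,3), (27360,88,7), (28284,88,7), (29259,88,11), (30228,88,5), (31266,88,5),
  (32196,88,5), (16650,89,7), (17185,89,3), (17767,89,3), (18355,89,3), (18868,89,3),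
  (19510,89,3), (20155,89,3), (20797,89,3), (21457,89,3), (22188,89,5), (22935,89,13),
  (23640,89,11), (24453,89,5), (25240,89,3), (26094,89,5), (26988,89,5), (27907,89,3),
  (28810,89,3), (29757,89,17), (30763,89,3), (31809,89,5), (16364,90,3), (16886,90,3),
  (17450,90,3), (17961,90,7), (18576,90,11), (19214,90,3), (19866,90,23), (20522,90,3),
  (21212,90,3), (21924,90,5), (22671,90,23), (23427,90,5), (24225,90,11), (25059,90,5),
  (25832,90,3), (26714,90,3), (27612,90,5), (28524,90,5), (29495,90,3), (30450,90,13),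
  (31490,90,3), (32541,90,11), (16815,91,7), (17371,91,3), (17922,91,5), (18507,91,5),
  (19116,91,5), (19765,91,3), (20353,91,3), (20997,91,5), (21690,91,7), (22420,91,3),
  (23191,91,3), (23983,91,3), (24796,91,3), (25635,91,7), (26505,91,7), (27391,91,3),
  (28315,91,3), (29283,91,23), (30270,91,19), (31206,91,5), (32203,91,3), (16655,92,3),
  (17214,92,13), (17781,92,5), (18305,92,3), (18936,92,5), (19565,92,3), (20219,92,3)] 1548972474155832068967529185281 = true := by
  decide +kernel

lemma chain_proth12 : prothChain 24948631463091782850856615785005057 [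
  (20865,92,7), (21584,92,3), (22319,92,3), (23063,92,3), (23781,92,5), (24573,92,5),
  (25364,92,3), (26183,92,3), (27051,92,5), (27924,92,19), (28883,92,3), (29865,92,13),
  (30860,92,3), (31916,92,3), (16497,93,11), (16932,93,7), (17500,93,3), (18004,93,3),
  (18604,93,3), (19200,93,7), (19828,93,3), (20488,93,3), (21180,93,13), (21867,93,7),
  (22615,93,3), (23374,93,3), (24157,93,3), (24955,93,3), (25800,93,29), (26683,93,3),
  (27552,93,11), (28410,93,11), (29380,93,3), (30345,93,13), (31345,93,3), (32407,93,3),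
  (16724,94,3), (17289,94,5), (17850,94,13), (18425,94,3), (19047,94,5), (19629,94,5),
  (20195,94,3), (20867,94,3), (21576,94,11), (22262,94,3), (23009,94,3), (23795,94,3),
  (24579,94,5), (25406,94,3), (26270,94,3), (27161,94,3), (27972,94,5), (28800,94,11),
  (29774,94,3), (30797,94,3), (31781,94,3), (16410,95,7), (16875,95,7), (17448,95,7),
  (18048,95,7), (18636,95,5), (19185,95,7), (19846,95,3), (20517,95,5), (21210,95,11),
  (21876,95,5), (22605,95,7), (23338,95,3), (24120,95,7), (24930,95,19), (25723,95,3),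
  (26542,95,3), (27426,95,5), (28357,95,3), (29311,95,3), (30243,95,13), (31278,95,7),
  (32352,95,5), (16703,96,3), (17255,96,3), (17850,96,11), (18464,96,3), (18983,96,3),
  (19559,96,3), (20150,96,3), (20840,96,3), (21546,96,5), (22280,96,3), (23036,96,3),
  (23826,96,5), (24540,96,13), (25373,96,3), (26174,96,3), (27056,96,3), (27983,96,3),
  (28883,96,3), (29874,96,17), (30903,96,5), (31956,96,5), (16510,97,3), (17074,97,3),
  (17655,97,7), (18258,97,5), (18852,97,7), (19492,97,3), (20160,97,13), (20715,97,11),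
  (21379,97,3), (22105,97,3), (22765,97,3), (23425,97,3), (24112,97,3), (24903,97,5),
  (25675,97,3), (26538,97,5), (27450,97,7), (28342,97,3), (29154,97,5), (30127,97,3),
  (31150,97,3), (32218,97,3), (16649,98,3), (17210,98,3), (17790,98,11), (18365,98,3),
  (18972,98,5), (19607,98,3), (20277,98,5), (20840,98,3), (21474,98,5), (22115,98,3),
  (22806,98,11), (23546,98,3), (24335,98,3), (25149,98,5), (26015,98,3), (26880,98,11),
  (27800,98,3), (28742,98,3), (29670,98,7), (30671,98,3), (31719,98,5), (16375,99,3),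
  (16876,99,3), (17373,99,7), (17952,99,5), (18465,99,7), (19077,99,5), (19681,99,3)] 200239277234488830225483141480449 = true := by
  decide +kernel

lemma chain_proth13 : prothChain 3099152187437975240779139996503244801 [
  (20346,99,5), (20971,99,3), (21510,99,7), (22245,99,7), (23008,99,3), (23791,99,3),
  (24607,99,3), (25435,99,3), (26271,99,5), (27042,99,5), (27951,99,5), (28897,99,3),
  (29881,99,3), (30882,99,5), (31878,99,13), (16463,100,3), (17025,100,7), (17531,100,3),
  (18123,100,5), (18614,100,3), (19239,100,7), (19833,100,5), (20478,100,5), (21170,100,3),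
  (21900,100,7), (22655,100,3), (23421,100,5), (24209,100,3), (25005,100,7), (25673,100,3),
  (26558,100,3), (27453,100,5), (28335,100,11), (29180,100,3), (30180,100,7), (31196,100,3),
  (32270,100,3), (16650,101,7), (17218,101,3), (17802,101,11), (18382,101,3), (19009,101,3),
  (19623,101,5), (20275,101,3), (20928,101,5), (21610,101,3), (22354,101,3), (23094,101,5),
  (23865,101,7), (24682,101,3), (25459,101,3), (26185,101,3), (27007,101,3), (27924,101,5),
  (28782,101,7), (29740,101,3), (30730,101,3), (31770,101,7), (16419,102,5), (16982,102,3),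
  (17565,102,7), (18156,102,13), (18731,102,3), (19352,102,3), (20019,102,5), (20630,102,3),
  (21329,102,3), (22049,102,3), (22680,102,11), (23450,102,3), (24191,102,3), (25016,102,3),
  (25772,102,3), (26600,102,3), (27474,102,5), (28394,102,3), (29339,102,3), (30350,102,3),
  (31385,102,3), (32466,102,11), (16530,103,7), (17095,103,3), (17682,103,5), (18258,103,11),
  (18778,103,3), (19378,103,3), (20028,103,7), (20658,103,7), (21363,103,11), (22072,103,3),
  (22740,103,7), (23505,103,11), (24286,103,3), (25078,103,3), (25833,103,7), (26665,103,3),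
  (27523,103,3), (28438,103,3), (29407,103,3), (30375,103,11), (31408,103,3), (32392,103,3),
  (16730,104,3), (17286,104,5), (17859,104,7), (18474,104,11), (18950,104,3), (19601,104,3),
  (20244,104,11), (20940,104,17), (21569,104,3), (22284,104,13), (22953,104,5), (23693,104,3),
  (24504,104,7), (25286,104,3), (26124,104,11), (27020,104,3), (27933,104,5), (28883,104,3),
  (29838,104,5), (30861,104,5), (31899,104,11), (16444,105,3), (16969,105,3), (17470,105,3),
  (18012,105,7), (18622,105,3), (19237,105,3), (19900,105,3), (20550,105,11), (21229,105,3),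
  (21837,105,11), (22582,105,3), (23353,105,3), (24130,105,3), (24928,105,3), (25753,105,3),
  (26605,105,3), (27502,105,3), (28450,105,3), (29388,105,5), (30379,105,3), (31414,105,3),
  (32484,105,5), (16785,106,13), (17346,106,19), (17891,106,3), (18479,106,3), (19100,106,3)] 24948631463091782850856615785005057 = true := by
  decide +kernel

lemma chain_proth14 : prothChain 4024030065364491412111134655145574401 [
  (19751,106,3), (20427,106,5), (21009,106,5), (21729,106,5), (22466,106,3), (23220,106,7),
  (24002,106,3), (24800,106,3)] 3099152187437975240779139996503244801 = true := by
  decide +kernel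

lemma chain_all (y : ℕ) (h1 : 331 ≤ y) (h2 : y < 4024030065364491412111134655145574401) : Link y := by
  obtain ⟨hp0, hs0⟩ := smallChain_sound _ _ _ (by norm_num) chain_small
  obtain ⟨hp1, hs1⟩ := prothChain_sound _ _ _ hp0 chain_proth0
  obtain ⟨hp2, hs2⟩ := prothChain_sound _ _ _ hp1 chain_proth1
  obtain ⟨hp3, hs3⟩ := prothChain_sound _ _ _ hp2 chain_proth2
  obtain ⟨hp4, hs4⟩ := prothChain_sound _ _ _ hp3 chain_proth3
  obtain ⟨hp5, hs5⟩ := prothChain_sound _ _ _ hp4 chain_proth4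
  obtain ⟨hp6, hs6⟩ := prothChain_sound _ _ _ hp5 chain_proth5
  obtain ⟨hp7, hs7⟩ := prothChain_sound _ _ _ hp6 chain_proth6
  obtain ⟨hp8, hs8⟩ := prothChain_sound _ _ _ hp7 chain_proth7
  obtain ⟨hp9, hs9⟩ := prothChain_sound _ _ _ hp8 chain_proth8
  obtain ⟨hp10, hs10⟩ := prothChain_sound _ _ _ hp9 chain_proth9
  obtain ⟨hp11, hs11⟩ := prothChain_sound _ _ _ hp10 chain_proth10
  obtain ⟨hp12, hs12⟩ := prothChain_sound _ _ _ hp11 chain_proth11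
  obtain ⟨hp13, hs13⟩ := prothChain_sound _ _ _ hp12 chain_proth12
  obtain ⟨hp14, hs14⟩ := prothChain_sound _ _ _ hp13 chain_proth13
  obtain ⟨hp15, hs15⟩ := prothChain_sound _ _ _ hp14 chain_proth14
  by_cases c0 : y < 4292521
  · exact hs0 y (by omega) c0
  by_cases c1 : y < 518946817
  · exact hs1 y (by omega) c1
  by_cases c2 : y < 77741424641
  · exact hs2 y (by omega) c2
  by_cases c3 : y < 11429981716481
  · exact hs3 y (by omega) c3
  by_cases c4 : y < 1671326393696257
  · exact hs4 y (by omega) c4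
  by_cases c5 : y < 243950843877916673
  · exact hs5 y (by omega) c5
  by_cases c6 : y < 34553868141000130561
  · exact hs6 y (by omega) c6
  by_cases c7 : y < 4897898781946037665793
  · exact hs7 y (by omega) c7
  by_cases c8 : y < 664599295487607725621249
  · exact hs8 y (by omega) c8
  by_cases c9 : y < 89833577603629260900139009
  · exact hs9 y (by omega) c9
  by_cases c10 : y < 12087444807416869803299700737
  · exact hs10 y (by omega) c10
  by_cases c11 : y < 1548972474155832068967529185281
  · exact hs11 y (by omega) c11
  by_cases c12 : y < 200239277234488830225483141480449
  · exact hs12 y (by omega) c12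
  by_cases c13 : y < 24948631463091782850856615785005057
  · exact hs13 y (by omega) c13
  by_cases c14 : y < 3099152187437975240779139996503244801
  · exact hs14 y (by omega) c14
  exact hs15 y (by omega) h2

/-- For every integer `r` with `2 ≤ r ≤ 29` and every integer `n ≥ 331·r`, there is a
prime `p` with `n/(r+1) < p ≤ n/r`, i.e. `n ∈ A_r = ⋃_{p prime} [r·p, (r+1)·p)`. -/
theorem prime_in_interval_small_r (r : ℕ) (hr1 : 2 ≤ r) (hr2 : r ≤ 29)
    (n : ℕ) (hn : 331 * r ≤ n) :
    ∃ p : ℕ, p.Prime ∧ (n : ℚ) / (r + 1) < (p : ℚ) ∧ (p : ℚ) ≤ (n : ℚ) / r := by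
  have hr0 : 0 < r := by omega
  suffices h : ∃ p : ℕ, p.Prime ∧ 29 * n < 30 * (r * p) ∧ p * r ≤ n by
    obtain ⟨p, hp, h1, h2⟩ := h
    refine ⟨p, hp, ?_, ?_⟩
    · rw [div_lt_iff₀ (by positivity)]
      have h3 : n < p * (r + 1) := by
        have : r * p ≤ 29 * p := Nat.mul_le_mul_right p hr2
        nlinarith
      exact_mod_cast h3
    · rw [le_div_iff₀ (by positivity)]
      exact_mod_cast h2
  by_cases hc : n / r < 4024030065364491412111134655145574401
  · obtain ⟨p, q, hp, h1, h2, h3⟩ := chain_all (n / r) ((Nat.le_div_iff_mul_le hr0).2 hn) hc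
    refine ⟨p, hp, ?_, (Nat.le_div_iff_mul_le hr0).1 h1⟩
    have h4 : n < q * r := (Nat.div_lt_iff_lt_mul hr0).1 h2
    have h5 : 29 * q * r ≤ 30 * p * r := Nat.mul_le_mul_right r h3
    nlinarith
  · push Not at hc
    have h1 := (Nat.le_div_iff_mul_le hr0).1 hc
    have hrR : (0 : ℝ) < r := by exact_mod_cast hr0
    have hx : (2 * 10 ^ 36 : ℝ) ≤ (n : ℝ) / r := by
      rw [le_div_iff₀ hrR]
      have h2 : 2 * 10 ^ 36 * r ≤ n := le_trans (Nat.mul_le_mul_right r (by norm_num)) h1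
      exact_mod_cast h2
    obtain ⟨p, hp, h2, h3⟩ := prime_large _ hx
    refine ⟨p, hp, ?_, ?_⟩
    · have h4 : (29 * n : ℝ) < 30 * (r * p) := by
        have h5 : (29 * ((n : ℝ) / r)) = 29 * n / r := by ring
        rw [h5, div_div, div_lt_iff₀ (by positivity)] at h2
        linarith
      exact_mod_cast h4
    · rw [le_div_iff₀ hrR] at h3
      exact_mod_cast h3
end
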